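/- arXiv:0907.0724 — 3 statements merged into one kernel-verified Lean document; each statement's English description precedes it below -/
import Mathlib

section
/- Let S be a set of n ≥ 59 points in ℝ³, no three collinear and not all coplanar. Let m be the number of planes determined by S and t the number of lines determined by S. Then m − t + n ≥ 2. -/
open Set

noncomputable section

/-- Three-dimensional euclidean space. -/
abbrev Pt3 := EuclideanSpace ℝ (Fin 3)

/-- A plane in space: the affine span of three affinely independent points. -/
def IsPlane (P : Set Pt3) : Prop :=
  ∃ a b c : Pt3, AffineIndependent ℝ ![a, b, c] ∧
    P = (affineSpan ℝ ({a, b, c} : Set Pt3) : Set Pt3)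

/-- `planeCount S k` is the number of planes containing exactly `k` points of `S`. -/
def planeCount (S : Set Pt3) (k : ℕ) : ℕ :=
  {P : Set Pt3 | IsPlane P ∧ (S ∩ P).ncard = k}.ncard

/-- The planes determined by `S`: planes containing at least three points of `S`. -/
def detPlanes (S : Set Pt3) : Set (Set Pt3) :=
  {P : Set Pt3 | IsPlane P ∧ 3 ≤ (S ∩ P).ncard}

/-- No three points of `S` are collinear. -/
def NoThreeCollinear (S : Set Pt3) : Prop :=
  ∀ T ⊆ S, T.ncard = 3 → ¬ Collinear ℝ T
/-- A line in space: the affine span of two distinct points. -/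
def IsLine3 (L : Set Pt3) : Prop :=
  ∃ p q : Pt3, p ≠ q ∧ L = (affineSpan ℝ ({p, q} : Set Pt3) : Set Pt3)

/-- The lines determined by `S`: lines containing at least two points of `S`. -/
def detLines3 (S : Set Pt3) : Set (Set Pt3) :=
  {L : Set Pt3 | IsLine3 L ∧ 2 ≤ (S ∩ L).ncard}

/-- Along the line `i`, the next point of `V` to the right of `v` is one where `i` minimizes `c`
among the lines through it. -/
def NextIsMin {ι : Type*} (U : Finset ι) (V : Finset (ℝ × ℝ)) (a b c : ι → ℝ)
    (v : ℝ × ℝ) (i : ι) : Prop :=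
  ∃ w ∈ V, a i * w.1 + b i = w.2 ∧ v.1 < w.1 ∧
    (∀ u ∈ V, a i * u.1 + b i = u.2 → v.1 < u.1 → w.1 ≤ u.1) ∧
    ∀ g ∈ U, a g * w.1 + b g = w.2 → c i ≤ c g

/-- The points of `V` on the line `i` all lie weakly to the left of `v`. -/
def IsLastOn {ι : Type*} (V : Finset (ℝ × ℝ)) (a b : ι → ℝ) (v : ℝ × ℝ) (i : ι) : Prop :=
  ∀ w ∈ V, a i * w.1 + b i = w.2 → w.1 ≤ v.1

open scoped Classical in
theorem card_filter_nextIsMin_le {ι : Type*} (U : Finset ι) (V : Finset (ℝ × ℝ)) (a b c : ι → ℝ)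
    (hc : Set.InjOn c U) :
    ((V ×ˢ U).filter fun q => a q.2 * q.1.1 + b q.2 = q.1.2 ∧
      NextIsMin U V a b c q.1 q.2).card ≤ V.card := by
  choose! f hfV hfon hflt hfnext hfmin using
    fun (q : (ℝ × ℝ) × ι) (h : NextIsMin U V a b c q.1 q.2) => h
  refine Finset.card_le_card_of_injOn f (fun q hq => ?_) ?_
  · simp only [Finset.coe_filter, Set.mem_ofPred_eq] at hq
    exact hfV q hq.2.2
  · rintro ⟨v, i⟩ hq ⟨v', i'⟩ hq' heq
    simp only [Finset.coe_filter, Finset.mem_product, Set.mem_ofPred_eq] at hq hq'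
    obtain ⟨⟨hv, hi⟩, hon, hN⟩ := hq
    obtain ⟨⟨hv', hi'⟩, hon', hN'⟩ := hq'
    have h1 := hfmin (v, i) hN i' hi' (heq ▸ hfon (v', i') hN')
    have h2 := hfmin (v', i') hN' i hi (heq ▸ hfon (v, i) hN)
    obtain rfl : i = i' := hc hi hi' (le_antisymm h1 h2)
    have hx : v.1 = v'.1 := by
      rcases lt_trichotomy v.1 v'.1 with h | h | h
      · have := hfnext (v, i) hN v' hv' hon' h
        have := hflt (v', i) hN'
        rw [heq] at *
        simp only at *
        linarith
      · exact h
      · have := hfnext (v', i) hN' v hv hon h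
        have := hflt (v, i) hN
        rw [heq] at *
        simp only at *
        linarith
    have : v = v' := Prod.ext hx (by rw [← hon, ← hon', hx])
    rw [this]

open scoped Classical in
theorem card_filter_isLastOn_le {ι : Type*} (U : Finset ι) (V : Finset (ℝ × ℝ)) (a b : ι → ℝ) :
    ((V ×ˢ U).filter fun q => a q.2 * q.1.1 + b q.2 = q.1.2 ∧
      IsLastOn V a b q.1 q.2).card ≤ U.card := by
  refine Finset.card_le_card_of_injOn Prod.snd (fun q hq => ?_) ?_
  · simp only [Finset.coe_filter, Finset.mem_product, Set.mem_ofPred_eq] at hq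
    exact hq.1.2
  · rintro ⟨v, i⟩ hq ⟨v', i'⟩ hq' heq
    simp only [Finset.coe_filter, Finset.mem_product, Set.mem_ofPred_eq] at hq hq' heq
    obtain rfl := heq
    obtain ⟨⟨hv, -⟩, hon, hL⟩ := hq
    obtain ⟨⟨hv', -⟩, hon', hL'⟩ := hq'
    have hx : v.1 = v'.1 := le_antisymm (hL' v hv hon) (hL v' hv' hon')
    have : v = v' := Prod.ext hx (by rw [← hon, ← hon', hx])
    rw [this]

theorem exists_next_of_not_isLastOn {ι : Type*} {V : Finset (ℝ × ℝ)} {a b : ι → ℝ}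
    {v : ℝ × ℝ} {i : ι} (h : ¬ IsLastOn V a b v i) :
    ∃ w ∈ V, a i * w.1 + b i = w.2 ∧ v.1 < w.1 ∧
      ∀ u ∈ V, a i * u.1 + b i = u.2 → v.1 < u.1 → w.1 ≤ u.1 := by
  classical
  simp only [IsLastOn, not_forall, not_le] at h
  obtain ⟨w₀, hw₀, hon, hlt⟩ := h
  obtain ⟨w, hw, hmin⟩ := (V.filter fun w => a i * w.1 + b i = w.2 ∧ v.1 < w.1).exists_min_image
    Prod.fst ⟨w₀, by simp [hw₀, hon, hlt]⟩
  simp only [Finset.mem_filter] at hw hmin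
  exact ⟨w, hw.1, hw.2.1, hw.2.2, fun u hu h1 h2 => hmin u ⟨hu, h1, h2⟩⟩

/-- If `v` is on two lines `i`, `j`, the point `w` is the next point on `i` and no point of `j`
lies strictly between `v` and `w`, then `i` has at `w` the extremal slope on its side of `j`. -/
theorem nextIsMin_of_next {ι : Type*} {U : Finset ι} {V : Finset (ℝ × ℝ)} {a b : ι → ℝ}
    (hV : ∀ i ∈ U, ∀ j ∈ U, a i ≠ a j → ∀ v : ℝ × ℝ, a i * v.1 + b i = v.2 →
      a j * v.1 + b j = v.2 → v ∈ V)
    {σ : ℝ} {v w : ℝ × ℝ} {i j : ι} (hj : j ∈ U) (hij : σ * a i < σ * a j)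
    (hvi : a i * v.1 + b i = v.2) (hvj : a j * v.1 + b j = v.2)
    (hw : w ∈ V) (hwi : a i * w.1 + b i = w.2) (hvw : v.1 < w.1)
    (hnext : ∀ u ∈ V, a i * u.1 + b i = u.2 → v.1 < u.1 → w.1 ≤ u.1)
    (hjw : ∀ u ∈ V, a j * u.1 + b j = u.2 → v.1 < u.1 → w.1 ≤ u.1) :
    NextIsMin U V a b (fun k => σ * a k) v i := by
  refine ⟨w, hw, hwi, hvw, hnext, fun g hg hwg => ?_⟩
  by_contra! hlt
  have hσ : σ * a g < σ * a j := hlt.trans hij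
  have hgj : 0 < σ * a j - σ * a g := by linarith
  have hne : a g ≠ a j := fun h => hσ.ne (by rw [h])
  set r := (σ * a i - σ * a g) / (σ * a j - σ * a g) with hr
  have hr0 : 0 < r := div_pos (by linarith) hgj
  have hr1 : r < 1 := by rw [hr, div_lt_one hgj]; linarith
  have hre : r * (a j - a g) = a i - a g := by
    have hσ0 : σ ≠ 0 := by rintro rfl; simp at hσ
    have h := div_mul_cancel₀ (σ * a i - σ * a g) hgj.ne'
    rw [← hr] at h
    apply mul_left_cancel₀ hσ0
    linarith
  set x := v.1 + r * (w.1 - v.1) with hx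
  have h1 : v.1 < x := by nlinarith
  have h2 : x < w.1 := by nlinarith
  have hcross : a g * x + b g = a j * x + b j := by
    rw [hx]
    linear_combination hwg - hwi + hvi - hvj - (w.1 - v.1) * hre
  have := hjw (x, a j * x + b j) (hV g hg j hj hne _ hcross rfl) rfl h1
  simp only at this
  linarith

open scoped Classical in
/-- A Melchior type inequality for a finite family of nonvertical, pairwise nonparallel lines. -/
theorem sum_card_incidences_le {ι : Type*} (U : Finset ι) (V : Finset (ℝ × ℝ)) (a b : ι → ℝ)
    (ha : Set.InjOn a U)
    (hV : ∀ i ∈ U, ∀ j ∈ U, a i ≠ a j → ∀ v : ℝ × ℝ, a i * v.1 + b i = v.2 →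
      a j * v.1 + b j = v.2 → v ∈ V) :
    ∑ v ∈ V, (U.filter fun i => a i * v.1 + b i = v.2).card ≤ 3 * V.card + U.card := by
  set I := (V ×ˢ U).filter fun q => a q.2 * q.1.1 + b q.2 = q.1.2 with hI
  have hsum : ∑ v ∈ V, (U.filter fun i => a i * v.1 + b i = v.2).card = I.card := by
    simp only [hI, Finset.card_filter, Finset.sum_product]
  set P := fun (σ : ℝ) (q : (ℝ × ℝ) × ι) => NextIsMin U V a b (fun k => σ * a k) q.1 q.2 with hP
  set L := fun q : (ℝ × ℝ) × ι => IsLastOn V a b q.1 q.2 with hL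
  have hinj : ∀ σ : ℝ, σ ≠ 0 → Set.InjOn (fun k => σ * a k) U := fun σ hσ i hi j hj h =>
    ha hi hj (mul_left_cancel₀ hσ h)
  have hPcard : ∀ σ : ℝ, σ ≠ 0 → (I.filter (P σ)).card ≤ V.card := fun σ hσ => by
    rw [hI, Finset.filter_filter]
    exact card_filter_nextIsMin_le U V a b _ (hinj σ hσ)
  have hLcard : (I.filter L).card ≤ U.card := by
    rw [hI, Finset.filter_filter]
    exact card_filter_isLastOn_le U V a b
  have hkey : ∀ v : ℝ × ℝ, ∀ i ∈ U, ∀ j ∈ U, a i < a j → a i * v.1 + b i = v.2 →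
      a j * v.1 + b j = v.2 → ¬ L (v, i) → ¬ L (v, j) → P 1 (v, i) ∨ P (-1) (v, j) := by
    intro v i hi j hj hij hvi hvj hLi hLj
    obtain ⟨w, hw, hwi, hvw, hwn⟩ := exists_next_of_not_isLastOn hLi
    obtain ⟨w', hw', hwj', hvw', hwn'⟩ := exists_next_of_not_isLastOn hLj
    rcases le_total w.1 w'.1 with h | h
    · exact Or.inl (nextIsMin_of_next hV hj (by linarith) hvi hvj hw hwi hvw hwn
        fun u hu hu1 hu2 => h.trans (hwn' u hu hu1 hu2))
    · exact Or.inr (nextIsMin_of_next hV hi (by linarith) hvj hvi hw' hwj' hvw' hwn'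
        fun u hu hu1 hu2 => h.trans (hwn u hu hu1 hu2))
  have hrest : (I.filter fun q => ¬ P 1 q ∧ ¬ P (-1) q ∧ ¬ L q).card ≤ V.card := by
    refine Finset.card_le_card_of_injOn Prod.fst (fun q hq => ?_) ?_
    · simp only [hI, Finset.coe_filter, Finset.mem_filter, Finset.mem_product,
        Set.mem_ofPred_eq] at hq
      exact hq.1.1.1
    · rintro ⟨v, i⟩ hq ⟨v', j⟩ hq' heq
      simp only [hI, Finset.coe_filter, Finset.mem_filter, Finset.mem_product,
        Set.mem_ofPred_eq] at hq hq' heq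
      obtain rfl := heq
      obtain ⟨⟨⟨-, hi⟩, hvi⟩, hi1, hi2, hi3⟩ := hq
      obtain ⟨⟨⟨-, hj⟩, hvj⟩, hj1, hj2, hj3⟩ := hq'
      rcases lt_trichotomy (a i) (a j) with h | h | h
      · rcases hkey v i hi j hj h hvi hvj hi3 hj3 with h | h <;> contradiction
      · rw [ha hi hj h]
      · rcases hkey v j hj i hi h hvj hvi hj3 hi3 with h | h <;> contradiction
  have hsub : I ⊆ I.filter (P 1) ∪ I.filter (P (-1)) ∪ I.filter L ∪
      I.filter fun q => ¬ P 1 q ∧ ¬ P (-1) q ∧ ¬ L q := by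
    intro q hq
    simp only [Finset.mem_union, Finset.mem_filter]
    tauto
  have h1 := hPcard 1 one_ne_zero
  have h2 := hPcard (-1) (by norm_num)
  have h3 := Finset.card_le_card hsub
  have h4 := Finset.card_union_le (I.filter (P 1) ∪ I.filter (P (-1)) ∪ I.filter L)
    (I.filter fun q => ¬ P 1 q ∧ ¬ P (-1) q ∧ ¬ L q)
  have h5 := Finset.card_union_le (I.filter (P 1) ∪ I.filter (P (-1))) (I.filter L)
  have h6 := Finset.card_union_le (I.filter (P 1)) (I.filter (P (-1)))
  omega

/-- Arithmetic for a block with `r` points and `k` points outside, in a design with `m` blocks. -/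
theorem large_block_arith {k r : ℤ} {m : ℤ} (hk : 1 ≤ k) (hr : 3 ≤ r) (hn : 59 ≤ k + r)
    (hbig : (r - 2) * (k + r - 2) < 3 * (r * (r - 1)))
    (h1 : k * r * (2 * 1 * (r - 1) - (k - 1)) ≤ 2 * (1 * (1 + 1)) * (m - 1))
    (h3 : k * r * (2 * 3 * (r - 1) - (k - 1)) ≤ 2 * (3 * (3 + 1)) * (m - 1)) :
    (k + r) * (k + r - 1) ≤ 2 * (m + (k + r) - 2) := by
  rcases le_or_gt k r with hkr | hkr
  · rcases le_or_gt 8 k with hk8 | hk8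
    · have a1 : 0 ≤ (r - k) * (k * r) := by
        apply mul_nonneg <;> [skip; apply mul_nonneg] <;> omega
      have a2 : 0 ≤ (k - 8) * (r * (r - 1)) := by
        apply mul_nonneg <;> [skip; apply mul_nonneg] <;> omega
      nlinarith
    · interval_cases k <;> nlinarith
  · have hr18 : 18 ≤ r := by
      by_contra! hlt
      interval_cases r <;> omega
    have hk2 : k ≤ 2 * r + 5 := by
      by_contra! hlt
      nlinarith
    have b1 : 0 ≤ k - r := by omega
    have b2 : 0 ≤ 2 * r + 5 - k := by omega
    have b3 : 0 ≤ r - 18 := by omega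
    have b4 : 0 ≤ k * r := mul_nonneg (by omega) (by omega)
    nlinarith [mul_nonneg b1 b2, mul_nonneg b4 b2, mul_nonneg b4 b3, mul_nonneg b1 b3]

/-- Every triple of points of `S` lies in exactly one member of the family `B` of subsets of `S`,
and the members of `B` have at least three points. -/
structure IsTripleDesign {α : Type*} (S : Finset α) (B : Finset (Finset α)) : Prop where
  subset : ∀ P ∈ B, P ⊆ S
  three_le : ∀ P ∈ B, 3 ≤ P.card
  exists_superset : ∀ T ⊆ S, T.card = 3 → ∃ P ∈ B, T ⊆ P
  eq_of_subset : ∀ T, T.card = 3 → ∀ P ∈ B, ∀ Q ∈ B, T ⊆ P → T ⊆ Q → P = Q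

namespace IsTripleDesign

variable {α : Type*} [DecidableEq α] {S : Finset α} {B : Finset (Finset α)}

theorem sum_choose_three (h : IsTripleDesign S B) :
    ∑ P ∈ B, P.card.choose 3 = S.card.choose 3 := by
  rw [← Finset.card_powersetCard 3 S]
  have : Finset.powersetCard 3 S = B.biUnion fun P => Finset.powersetCard 3 P := by
    ext T
    simp only [Finset.mem_powersetCard, Finset.mem_biUnion]
    constructor
    · rintro ⟨h1, h2⟩
      obtain ⟨P, hP, hT⟩ := h.exists_superset T h1 h2
      exact ⟨P, hP, hT, h2⟩
    · rintro ⟨P, hP, hT, h2⟩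
      exact ⟨hT.trans (h.subset P hP), h2⟩
  rw [this, Finset.card_biUnion]
  · simp
  · intro P hP Q hQ hPQ
    refine Finset.disjoint_left.2 fun T hT hT' => ?_
    rw [Finset.mem_powersetCard] at hT hT'
    exact hPQ (h.eq_of_subset T hT.2 P hP Q hQ hT.1 hT'.1)

theorem card_inter_le_two (h : IsTripleDesign S B) {P Q : Finset α} (hP : P ∈ B) (hQ : Q ∈ B)
    (hPQ : P ≠ Q) : (P ∩ Q).card ≤ 2 := by
  by_contra! hlt
  obtain ⟨T, hT, hT3⟩ := Finset.exists_subset_card_eq (Nat.succ_le_of_lt hlt)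
  exact hPQ (h.eq_of_subset T hT3 P hP Q hQ (hT.trans Finset.inter_subset_left)
    (hT.trans Finset.inter_subset_right))

/-- The blocks through `q` meeting `P` in two points: at least one for each pair in `P`. -/
theorem choose_two_le_card (h : IsTripleDesign S B) {P : Finset α} (hP : P ∈ B) {q : α}
    (hq : q ∈ S \ P) :
    P.card.choose 2 ≤ (B.filter fun Q => (Q ∩ P).card = 2 ∧ q ∈ Q).card := by
  rw [← Finset.card_powersetCard 2 P]
  rw [Finset.mem_sdiff] at hq
  refine Finset.card_le_card_of_surjOn (fun Q => Q ∩ P) fun T hT => ?_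
  simp only [Finset.mem_coe, Finset.mem_powersetCard] at hT
  have hqT : q ∉ T := fun hh => hq.2 (hT.1 hh)
  obtain ⟨Q, hQ, hTQ⟩ := h.exists_superset (insert q T)
    (Finset.insert_subset hq.1 (hT.1.trans (h.subset P hP)))
    (by rw [Finset.card_insert_of_notMem hqT, hT.2])
  rw [Finset.insert_subset_iff] at hTQ
  have hne : Q ≠ P := by rintro rfl; exact hq.2 hTQ.1
  have heq : T = Q ∩ P := Finset.eq_of_subset_of_card_le (Finset.subset_inter hTQ.2 hT.1)
    (by rw [hT.2]; exact h.card_inter_le_two hQ hP hne)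
  refine ⟨Q, ?_, heq.symm⟩
  simp only [Finset.coe_filter, Set.mem_ofPred_eq]
  exact ⟨hQ, heq ▸ hT.2, hTQ.1⟩

/-- The blocks through `q` and `q'` meet `P` in disjoint sets. -/
theorem two_mul_card_le (h : IsTripleDesign S B) {P : Finset α} {q q' : α}
    (hq : q ∈ S \ P) (hq' : q' ∈ S \ P) (hne : q ≠ q') :
    2 * (B.filter fun Q => (Q ∩ P).card = 2 ∧ q ∈ Q ∧ q' ∈ Q).card ≤ P.card := by
  rw [Finset.mem_sdiff] at hq hq'
  set C := B.filter fun Q => (Q ∩ P).card = 2 ∧ q ∈ Q ∧ q' ∈ Q with hC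
  have hdisj : ∀ Q ∈ C, ∀ R ∈ C, Q ≠ R → Disjoint (Q ∩ P) (R ∩ P) := by
    intro Q hQ R hR hQR
    simp only [hC, Finset.mem_filter] at hQ hR
    rw [Finset.disjoint_left]
    intro x hx hx'
    rw [Finset.mem_inter] at hx hx'
    have hxq : x ≠ q := by rintro rfl; exact hq.2 hx.2
    have hxq' : x ≠ q' := by rintro rfl; exact hq'.2 hx.2
    refine hQR (h.eq_of_subset {x, q, q'} (Finset.card_eq_three.2 ⟨x, q, q', hxq, hxq', hne, rfl⟩)
      Q hQ.1 R hR.1 ?_ ?_) <;> simp [Finset.insert_subset_iff, *]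
  have hsum : (C.biUnion fun Q => Q ∩ P).card = ∑ Q ∈ C, 2 := by
    rw [Finset.card_biUnion hdisj]
    exact Finset.sum_congr rfl fun Q hQ => (Finset.mem_filter.1 hQ).2.1
  have hle : (C.biUnion fun Q => Q ∩ P).card ≤ P.card :=
    Finset.card_le_card (Finset.biUnion_subset.2 fun Q _ => Finset.inter_subset_right)
  rw [hsum, Finset.sum_const, smul_eq_mul] at hle
  omega

/-- A Bonferroni type lower bound for the number of blocks, given a block `P`. -/
theorem card_lower_bound (h : IsTripleDesign S B) {P : Finset α} (hP : P ∈ B) (c : ℤ)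
    (hc : 0 ≤ c) :
    ((S \ P).card : ℤ) * P.card * (2 * c * (P.card - 1) - ((S \ P).card - 1)) ≤
      2 * (c * (c + 1)) * (B.card - 1) := by
  set O := S \ P with hO
  set C := B.filter fun Q => (Q ∩ P).card = 2 with hC
  have hCcard : (C.card : ℤ) ≤ B.card - 1 := by
    have : C ⊆ B.erase P := by
      intro Q hQ
      rw [hC, Finset.mem_filter] at hQ
      refine Finset.mem_erase.2 ⟨?_, hQ.1⟩
      rintro rfl
      have := h.three_le Q hP
      rw [Finset.inter_self] at hQ
      omega
    have := Finset.card_le_card this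
    rw [Finset.card_erase_of_mem hP] at this
    have : 0 < B.card := Finset.card_pos.2 ⟨P, hP⟩
    omega
  have hfirst : O.card * P.card.choose 2 ≤ ∑ Q ∈ C, (O.filter fun q => q ∈ Q).card := by
    simp only [Finset.card_filter]
    rw [Finset.sum_comm, ← smul_eq_mul]
    refine Finset.card_nsmul_le_sum _ _ _ fun q hq => ?_
    rw [← Finset.card_filter, hC, Finset.filter_filter]
    exact h.choose_two_le_card hP hq
  have hsecond : 2 * ∑ Q ∈ C, (O.filter fun q => q ∈ Q).offDiag.card ≤ O.offDiag.card * P.card := by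
    have : ∀ Q : Finset α, (O.filter fun q => q ∈ Q).offDiag = O.offDiag.filter fun x => x.1 ∈ Q ∧ x.2 ∈ Q := by
      intro Q
      ext x
      simp only [Finset.mem_offDiag, Finset.mem_filter]
      tauto
    simp only [this, Finset.card_filter]
    rw [Finset.sum_comm, Finset.mul_sum, ← smul_eq_mul]
    refine Finset.sum_le_card_nsmul _ _ _ fun x hx => ?_
    rw [Finset.mem_offDiag] at hx
    rw [← Finset.card_filter, hC, Finset.filter_filter]
    exact h.two_mul_card_le hx.1 hx.2.1 hx.2.2
  have hoff : ∀ X : Finset α, (X.offDiag.card : ℤ) = X.card * (X.card - 1) := by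
    intro X
    rw [Finset.offDiag_card, Nat.cast_sub (Nat.le_mul_self _)]
    push_cast
    ring
  have hpt : ∀ Q ∈ C, 2 * c * ((O.filter fun q => q ∈ Q).card : ℤ) -
      ((O.filter fun q => q ∈ Q).offDiag.card : ℤ) ≤ c * (c + 1) := by
    intro Q _
    rw [hoff]
    set s : ℤ := ((O.filter fun q => q ∈ Q).card : ℤ)
    have : 0 ≤ (s - c) * (s - c - 1) := by
      rcases le_or_gt s c with hs | hs
      · nlinarith
      · exact mul_nonneg (by omega) (by omega)
    nlinarith
  have hsum := Finset.sum_le_sum hpt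
  rw [Finset.sum_sub_distrib, ← Finset.mul_sum, Finset.sum_const, nsmul_eq_mul] at hsum
  have hch : (2 : ℤ) * (P.card.choose 2 : ℕ) = P.card * (P.card - 1) := by
    have := Nat.choose_two_right P.card
    have h2 := Nat.even_mul_pred_self P.card
    have h3 : 2 * P.card.choose 2 = P.card * (P.card - 1) := by
      rw [this]; exact Nat.mul_div_cancel' h2.two_dvd
    have h4 : 1 ≤ P.card := by have := h.three_le P hP; omega
    zify [h4] at h3
    exact h3
  zify at hfirst hsecond
  rw [hoff O] at hsecond
  have e1 := mul_le_mul_of_nonneg_left hfirst (show 0 ≤ 4 * c by omega)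
  have e2 := mul_le_mul_of_nonneg_left hCcard (show 0 ≤ 2 * (c * (c + 1)) by positivity)
  have e3 : 4 * c * ((O.card : ℤ) * (P.card.choose 2 : ℕ)) =
      2 * c * O.card * (P.card * (P.card - 1)) := by rw [← hch]; ring
  nlinarith

theorem sum_sq_le (h : IsTripleDesign S B)
    (hM : ∀ p ∈ S, ∑ P ∈ B.filter (p ∈ ·), (P.card - 1) ≤
      3 * (B.filter (p ∈ ·)).card + (S.card - 1)) :
    ∑ P ∈ B, (P.card : ℤ) * (P.card - 4) ≤ S.card * (S.card - 1) := by
  have hM' : ∀ p ∈ S, ∑ P ∈ B.filter (p ∈ ·), ((P.card : ℤ) - 4) ≤ S.card - 1 := by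
    intro p hp
    have := hM p hp
    have h1 : ((∑ P ∈ B.filter (p ∈ ·), (P.card - 1) : ℕ) : ℤ) =
        ∑ P ∈ B.filter (p ∈ ·), ((P.card : ℤ) - 1) := by
      rw [Nat.cast_sum]
      refine Finset.sum_congr rfl fun P hP => ?_
      have := h.three_le P (Finset.mem_filter.1 hP).1
      omega
    have h2 : 1 ≤ S.card := Finset.card_pos.2 ⟨p, hp⟩
    zify [h2] at this
    rw [Finset.sum_sub_distrib, Finset.sum_const, nsmul_eq_mul] at h1 ⊢
    push_cast at this h1
    linarith
  have hs := Finset.sum_le_sum hM'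
  rw [Finset.sum_const, nsmul_eq_mul] at hs
  refine le_trans (le_of_eq ?_) hs
  simp only [Finset.sum_filter]
  rw [Finset.sum_comm]
  refine Finset.sum_congr rfl fun P hP => ?_
  rw [← Finset.sum_filter, Finset.sum_const, nsmul_eq_mul,
    Finset.filter_mem_eq_inter, Finset.inter_eq_right.2 (h.subset P hP)]

theorem choose_two_le (h : IsTripleDesign S B) (hS : 59 ≤ S.card) (hSB : S ∉ B)
    (hM : ∀ p ∈ S, ∑ P ∈ B.filter (p ∈ ·), (P.card - 1) ≤
      3 * (B.filter (p ∈ ·)).card + (S.card - 1)) :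
    (S.card.choose 2 : ℤ) ≤ B.card + S.card - 2 := by
  have hch2 : (2 : ℤ) * (S.card.choose 2 : ℕ) = S.card * (S.card - 1) := by
    have h3 : 2 * S.card.choose 2 = S.card * (S.card - 1) := by
      rw [Nat.choose_two_right]
      exact Nat.mul_div_cancel' (Nat.even_mul_pred_self S.card).two_dvd
    zify [show 1 ≤ S.card by omega] at h3
    exact h3
  by_cases hbig : ∃ P ∈ B, ((P.card : ℤ) - 2) * (S.card - 2) < 3 * (P.card * (P.card - 1))
  · obtain ⟨P, hP, hlt⟩ := hbig
    have hsub := h.subset P hP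
    have hk : 0 < (S \ P).card := Finset.card_pos.2 (Finset.sdiff_nonempty.2 fun hle =>
      hSB (Finset.Subset.antisymm hsub hle ▸ hP))
    have hn := Finset.card_sdiff_add_card_eq_card hsub
    have h1 := h.card_lower_bound hP 1 (by norm_num)
    have h3 := h.card_lower_bound hP 3 (by norm_num)
    have hr := h.three_le P hP
    rw [← hn] at hch2 hlt hS ⊢
    push_cast at hch2 hlt ⊢
    have := large_block_arith (by omega) (by omega) (by omega) hlt h1 h3
    linarith
  · push Not at hbig
    have hch3 : ∀ k : ℕ, 2 ≤ k → (6 : ℤ) * (k.choose 3 : ℕ) = k * (k - 1) * (k - 2) := by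
      intro k hk
      have := Nat.descFactorial_eq_factorial_mul_choose k 3
      simp only [Nat.descFactorial_succ, Nat.descFactorial_zero, Nat.factorial, Nat.sub_zero] at this
      zify [show 1 ≤ k by omega, hk] at this
      push_cast at this
      linarith
    have hpt : ∀ P ∈ B, (18 : ℤ) * (P.card.choose 3 : ℕ) ≤
        (S.card - 2) * (4 + P.card * (P.card - 4)) := by
      intro P hP
      have h1 := hbig P hP
      have h2 := h.three_le P hP
      have h3 := hch3 P.card (by omega)
      nlinarith [mul_le_mul_of_nonneg_left h1 (show (0 : ℤ) ≤ P.card - 2 by omega)]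
    have hsum := Finset.sum_le_sum hpt
    rw [← Finset.mul_sum, ← Finset.mul_sum, Finset.sum_add_distrib, Finset.sum_const,
      nsmul_eq_mul, ← Nat.cast_sum, h.sum_choose_three] at hsum
    have hsq := h.sum_sq_le hM
    have hS3 := hch3 S.card (by omega)
    have h2 : (0 : ℤ) < S.card - 2 := by omega
    have : ((S.card : ℤ) - 2) * (3 * (S.card * (S.card - 1))) ≤
        (S.card - 2) * (B.card * 4 + S.card * (S.card - 1)) := by
      nlinarith [mul_le_mul_of_nonneg_left hsq h2.le]
    have := le_of_mul_le_mul_left this h2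
    linarith

end IsTripleDesign

theorem IsPlane.eq_affineSpan {P : Set Pt3} (hP : IsPlane P) {p q r : Pt3}
    (hpqr : ¬ Collinear ℝ ({p, q, r} : Set Pt3)) (hsub : {p, q, r} ⊆ P) :
    P = affineSpan ℝ ({p, q, r} : Set Pt3) := by
  obtain ⟨a, b, c, habc, rfl⟩ := hP
  rw [← affineIndependent_iff_not_collinear_set] at hpqr
  have hrange : ∀ x y z : Pt3, Set.range ![x, y, z] = {x, y, z} := fun x y z => by
    simp only [Matrix.range_cons, Matrix.range_empty, Set.singleton_union, insert_empty_eq]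
  have hle := affineSpan_le.2 hsub
  have hfin : Module.finrank ℝ (affineSpan ℝ ({a, b, c} : Set Pt3)).direction = 2 := by
    rw [direction_affineSpan, ← hrange]
    exact habc.finrank_vectorSpan (by simp)
  rw [← hrange p q r] at hle ⊢
  rw [hpqr.affineSpan_eq_of_le_of_card_eq_finrank_add_one hle (by rw [hfin]; simp)]

theorem IsPlane.coplanar {P : Set Pt3} (hP : IsPlane P) : Coplanar ℝ P := by
  obtain ⟨a, b, c, -, rfl⟩ := hP
  have h := coplanar_triple ℝ a b c
  rw [coplanar_iff_finrank_le_two] at h ⊢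
  rwa [← AffineSubspace.direction_eq_vectorSpan, direction_affineSpan]

/-- The plane spanned by three noncollinear points, as the zero set of a functional. -/
theorem mem_affineSpan_iff_apply_eq_zero {ν : Module.Dual ℝ Pt3} (hν : ν ≠ 0) {p q r : Pt3}
    (hpqr : ¬ Collinear ℝ ({p, q, r} : Set Pt3)) (hq : ν (q - p) = 0) (hr : ν (r - p) = 0)
    (z : Pt3) : z ∈ affineSpan ℝ ({p, q, r} : Set Pt3) ↔ ν (z - p) = 0 := by
  have hrange : Set.range ![p, q, r] = {p, q, r} := by
    simp only [Matrix.range_cons, Matrix.range_empty, Set.singleton_union, insert_empty_eq]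
  have hle : affineSpan ℝ ({p, q, r} : Set Pt3) ≤ AffineSubspace.mk' p (LinearMap.ker ν) := by
    rw [affineSpan_le]
    rintro x (rfl | rfl | rfl) <;> simp [AffineSubspace.mem_mk', hq, hr]
  rw [← affineIndependent_iff_not_collinear_set] at hpqr
  have hfin := Module.Dual.finrank_ker_add_one_of_ne_zero hν
  rw [finrank_euclideanSpace_fin] at hfin
  rw [← hrange] at hle ⊢
  rw [hpqr.affineSpan_eq_of_le_of_card_eq_finrank_add_one hle
    (by rw [AffineSubspace.direction_mk', hfin]; simp), AffineSubspace.mem_mk']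
  simp

/-- Coordinates in which the directions from `p` to the points of `U` become the points
`(α u / φ u, β u / φ u)` of an affine plane, with distinct first coordinates. -/
theorem exists_generic_functionals (U : Finset Pt3) (p : Pt3) (hp : p ∉ U)
    (hU : ∀ q ∈ U, ∀ r ∈ U, q ≠ r → ¬ Collinear ℝ ({p, q, r} : Set Pt3)) :
    ∃ φ α β : Module.Dual ℝ Pt3, (∀ q ∈ U, φ (q - p) ≠ 0) ∧
      (Set.InjOn (fun q => α (q - p) / φ (q - p)) U) ∧
      ∀ x y : ℝ, x • α + β - y • φ ≠ 0 := by
  obtain ⟨φ, hφ⟩ := Module.exists_dual_forall_apply_ne_zero (K := ℝ)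
    (fun q : U => (q : Pt3) - p) fun q h => hp (sub_eq_zero.1 h ▸ q.2)
  have hv : ∀ s : {s : U × U // s.1 ≠ s.2},
      φ (s.1.2 - p) • ((s.1.1 : Pt3) - p) - φ (s.1.1 - p) • ((s.1.2 : Pt3) - p) ≠ 0 := by
    rintro ⟨⟨q, r⟩, hne⟩ h
    refine hU q q.2 r r.2 (fun h => hne (Subtype.ext h)) ?_
    rw [collinear_iff_of_mem (p₀ := p) (by simp)]
    refine ⟨r - p, ?_⟩
    simp only at h
    rintro x (rfl | rfl | rfl)
    · exact ⟨0, by simp⟩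
    · refine ⟨(φ (r - p))⁻¹ * φ (q - p), ?_⟩
      rw [mul_smul, ← sub_eq_zero.1 h, smul_smul, inv_mul_cancel₀ (hφ r), one_smul]
      simp
    · exact ⟨1, by simp⟩
  obtain ⟨α, hα⟩ := Module.exists_dual_forall_apply_ne_zero (K := ℝ) _ hv
  obtain ⟨e, he, he0⟩ := Submodule.exists_mem_ne_zero_of_ne_bot
    (LinearMap.ker_ne_bot_of_finrank_lt (f := φ.prod α) (by simp))
  obtain ⟨β, hβ⟩ : ∃ β : Module.Dual ℝ Pt3, β e ≠ 0 := by
    by_contra! h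
    exact he0 ((Module.forall_dual_apply_eq_zero_iff ℝ e).1 h)
  have he1 : φ e = 0 := congrArg Prod.fst he
  have he2 : α e = 0 := congrArg Prod.snd he
  refine ⟨φ, α, β, fun q hq => hφ ⟨q, hq⟩, fun q hq r hr h => ?_, fun x y h => hβ ?_⟩
  · by_contra hne
    have h1 := hα ⟨(⟨q, hq⟩, ⟨r, hr⟩), fun h => hne (congrArg Subtype.val h)⟩
    refine h1 ?_
    simp only [map_sub, map_smul, smul_eq_mul] at h ⊢
    simp only [← map_sub] at h ⊢
    rw [div_eq_div_iff (hφ ⟨q, hq⟩) (hφ ⟨r, hr⟩)] at h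
    linarith
  · have := LinearMap.congr_fun h e
    simpa [he1, he2] using this

open scoped Classical in
/-- The blocks of `S`: the traces on `S` of the determined planes. -/
def planeTraces (S : Finset Pt3) : Finset (Finset Pt3) :=
  S.powerset.filter fun T => ∃ P ∈ detPlanes S, (T : Set Pt3) = (S : Set Pt3) ∩ P

theorem mem_planeTraces {S T : Finset Pt3} :
    T ∈ planeTraces S ↔ ∃ P ∈ detPlanes S, (T : Set Pt3) = (S : Set Pt3) ∩ P := by
  simp only [planeTraces, Finset.mem_filter, Finset.mem_powerset, and_iff_right_iff_imp]
  rintro ⟨P, -, h⟩ x hx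
  exact (h.subset hx).1

theorem NoThreeCollinear.not_collinear {S : Set Pt3} (h3 : NoThreeCollinear S) {p q r : Pt3}
    (hp : p ∈ S) (hq : q ∈ S) (hr : r ∈ S) (hpq : p ≠ q) (hpr : p ≠ r) (hqr : q ≠ r) :
    ¬ Collinear ℝ ({p, q, r} : Set Pt3) :=
  h3 _ (by rintro x (rfl | rfl | rfl) <;> assumption)
    (Set.ncard_eq_three.2 ⟨p, q, r, hpq, hpr, hqr, rfl⟩)

theorem isTripleDesign_planeTraces {S : Finset Pt3} (h3 : NoThreeCollinear S) :
    IsTripleDesign S (planeTraces S) where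
  subset T hT x hx := by
    obtain ⟨P, -, h⟩ := mem_planeTraces.1 hT
    exact (h.subset hx).1
  three_le T hT := by
    obtain ⟨P, hP, h⟩ := mem_planeTraces.1 hT
    rw [← Set.ncard_coe_finset, h]
    exact hP.2
  exists_superset T hTS hT := by
    classical
    obtain ⟨p, q, r, hpq, hpr, hqr, rfl⟩ := Finset.card_eq_three.1 hT
    simp only [Finset.insert_subset_iff, Finset.singleton_subset_iff] at hTS
    have hnc := h3.not_collinear hTS.1 hTS.2.1 hTS.2.2 hpq hpr hqr
    obtain ⟨P, hP⟩ : ∃ P : Set Pt3, P = affineSpan ℝ ({p, q, r} : Set Pt3) := ⟨_, rfl⟩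
    have hsub : {p, q, r} ⊆ P := hP ▸ subset_affineSpan ℝ _
    have hsub' : (({p, q, r} : Finset Pt3) : Set Pt3) ⊆ S ∩ P := by
      refine Set.subset_inter ?_ (by simpa using hsub)
      simpa [Set.insert_subset_iff] using hTS
    refine ⟨S.filter (· ∈ P), mem_planeTraces.2 ⟨P, ⟨⟨p, q, r,
      affineIndependent_iff_not_collinear_set.2 hnc, hP⟩, ?_⟩, by ext; simp⟩, ?_⟩
    · rw [← hT, ← Set.ncard_coe_finset]
      exact Set.ncard_le_ncard hsub' (S.finite_toSet.inter_of_left P)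
    · intro x hx
      have := hsub' hx
      simpa using this
  eq_of_subset T hT Q hQ R hR hTQ hTR := by
    classical
    obtain ⟨p, q, r, hpq, hpr, hqr, rfl⟩ := Finset.card_eq_three.1 hT
    obtain ⟨P, hP, hPQ⟩ := mem_planeTraces.1 hQ
    obtain ⟨P', hP', hPR⟩ := mem_planeTraces.1 hR
    have h1 : ({p, q, r} : Set Pt3) ⊆ S ∩ P := by
      rw [← hPQ]; simpa using Finset.coe_subset.2 hTQ
    have h2 : ({p, q, r} : Set Pt3) ⊆ S ∩ P' := by
      rw [← hPR]; simpa using Finset.coe_subset.2 hTR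
    have hnc := h3.not_collinear (h1 (by simp : p ∈ _)).1 (h1 (by simp : q ∈ _)).1
      (h1 (by simp : r ∈ _)).1 hpq hpr hqr
    rw [← Finset.coe_inj, hPQ, hPR, hP.1.eq_affineSpan hnc (h1.trans Set.inter_subset_right),
      hP'.1.eq_affineSpan hnc (h2.trans Set.inter_subset_right)]

theorem card_planeTraces_le_ncard {S : Finset Pt3} (h3 : NoThreeCollinear S) :
    (planeTraces S).card ≤ (detPlanes S).ncard := by
  classical
  have hfin : (detPlanes (S : Set Pt3)).Finite := by
    refine Set.Finite.of_finite_image (f := fun P => (S : Set Pt3) ∩ P)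
      (S.finite_toSet.finite_subsets.subset ?_) ?_
    · rintro _ ⟨P, -, rfl⟩
      exact Set.inter_subset_left
    · intro P hP P' hP' heq
      simp only at heq
      obtain ⟨T, hT, hT3⟩ := Set.exists_subset_card_eq hP.2
      obtain ⟨p, q, r, hpq, hpr, hqr, rfl⟩ := Set.ncard_eq_three.1 hT3
      have hnc := h3 _ (hT.trans Set.inter_subset_left) hT3
      rw [hP.1.eq_affineSpan hnc (hT.trans Set.inter_subset_right),
        hP'.1.eq_affineSpan hnc ((heq ▸ hT).trans Set.inter_subset_right)]
  rw [Set.ncard_eq_toFinset_card _ hfin]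
  refine Finset.card_le_card_of_surjOn (fun P => S.filter (· ∈ P)) fun T hT => ?_
  obtain ⟨P, hP, h⟩ := mem_planeTraces.1 hT
  refine ⟨P, by simpa using hP, ?_⟩
  rw [← Finset.coe_inj, h]
  ext
  simp

theorem ncard_detLines3_le (S : Finset Pt3) : (detLines3 S).ncard ≤ S.card.choose 2 := by
  classical
  have hsub : detLines3 (S : Set Pt3) ⊆ ((Finset.powersetCard 2 S).image
      fun T : Finset Pt3 => (affineSpan ℝ (T : Set Pt3) : Set Pt3) : Finset (Set Pt3)) := by
    rintro L ⟨⟨p, q, hpq, rfl⟩, h2⟩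
    obtain ⟨T, hT, hT2⟩ := Set.exists_subset_card_eq h2
    obtain ⟨x, y, hxy, rfl⟩ := Set.ncard_eq_two.1 hT2
    have hx := hT (by simp : x ∈ _)
    have hy := hT (by simp : y ∈ _)
    rw [Finset.coe_image]
    refine ⟨{x, y}, ?_, ?_⟩
    · rw [Finset.mem_coe, Finset.mem_powersetCard]
      refine ⟨?_, Finset.card_pair hxy⟩
      simp only [Finset.insert_subset_iff, Finset.singleton_subset_iff]
      exact ⟨hx.1, hy.1⟩
    · simp only [Finset.coe_insert, Finset.coe_singleton]
      have := affineSpan_pair_eq_of_mem_of_mem_of_ne hx.2 hy.2 hxy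
      rw [this]
  refine (Set.ncard_le_ncard hsub (Finset.finite_toSet _)).trans ?_
  rw [Set.ncard_coe_finset]
  exact Finset.card_image_le.trans (Finset.card_powersetCard 2 S).le

open scoped Classical in
/-- Melchior type inequality for the planes through a point `p` of `S`. -/
theorem sum_card_planeTraces_le {S : Finset Pt3} (h3 : NoThreeCollinear S) {p : Pt3}
    (hp : p ∈ S) : ∑ P ∈ (planeTraces S).filter (p ∈ ·), (P.card - 1) ≤
      3 * ((planeTraces S).filter (p ∈ ·)).card + (S.card - 1) := by
  have hD := isTripleDesign_planeTraces h3
  set U := S.erase p with hU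
  have hnc : ∀ q ∈ U, ∀ r ∈ U, q ≠ r → ¬ Collinear ℝ ({p, q, r} : Set Pt3) := by
    intro q hq r hr hqr
    rw [hU, Finset.mem_erase] at hq hr
    exact h3.not_collinear hp hq.2 hr.2 hq.1.symm hr.1.symm hqr
  obtain ⟨φ, α, β, hφ, hinj, hν⟩ := exists_generic_functionals U p (by simp [hU]) hnc
  set a : Pt3 → ℝ := fun q => α (q - p) / φ (q - p) with ha
  set b : Pt3 → ℝ := fun q => β (q - p) / φ (q - p) with hb
  have hon : ∀ q ∈ U, ∀ x y : ℝ, a q * x + b q = y ↔ (x • α + β - y • φ) (q - p) = 0 := by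
    intro q hq x y
    have := hφ q hq
    simp only [ha, hb, LinearMap.sub_apply, LinearMap.add_apply, LinearMap.smul_apply, smul_eq_mul]
    rw [div_mul_eq_mul_div, ← add_div, div_eq_iff this, sub_eq_zero, mul_comm x]
  have huniq : ∀ q ∈ U, ∀ r ∈ U, q ≠ r → ∀ v w : ℝ × ℝ, a q * v.1 + b q = v.2 →
      a r * v.1 + b r = v.2 → a q * w.1 + b q = w.2 → a r * w.1 + b r = w.2 → v = w := by
    intro q hq r hr hqr v w h1 h2 h3 h4
    have hne : a q - a r ≠ 0 := sub_ne_zero.2 fun h => hqr (hinj hq hr h)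
    have hx : v.1 = w.1 := mul_left_cancel₀ hne (by linarith)
    exact Prod.ext hx (by rw [← h1, ← h3, hx])
  have hex : ∀ T ∈ (planeTraces S).filter (p ∈ ·), ∃ v : ℝ × ℝ,
      ∀ q ∈ U, q ∈ T ↔ a q * v.1 + b q = v.2 := by
    intro T hT
    rw [Finset.mem_filter] at hT
    obtain ⟨P, hP, hTP⟩ := mem_planeTraces.1 hT.1
    have hcard : 1 < (T.erase p).card := by
      have := hD.three_le T hT.1
      rw [Finset.card_erase_of_mem hT.2]
      omega
    obtain ⟨q, hq, r, hr, hqr⟩ := Finset.one_lt_card.1 hcard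
    have hsubU : T.erase p ⊆ U := Finset.erase_subset_erase p (hD.subset T hT.1)
    have hqU := hsubU hq
    have hrU := hsubU hr
    have hPm : ∀ z ∈ T, z ∈ P := fun z hz => (hTP.subset hz).2
    have hPeq := hP.1.eq_affineSpan (hnc q hqU r hrU hqr) (by
      rintro x (rfl | rfl | rfl)
      · exact hPm _ hT.2
      · exact hPm _ (Finset.mem_of_mem_erase hq)
      · exact hPm _ (Finset.mem_of_mem_erase hr))
    have hne : a q - a r ≠ 0 := sub_ne_zero.2 fun h => hqr (hinj hqU hrU h)
    set x := (b r - b q) / (a q - a r) with hx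
    have hxe : x * (a q - a r) = b r - b q := div_mul_cancel₀ _ hne
    refine ⟨(x, a q * x + b q), fun z hz => ?_⟩
    have hiff := mem_affineSpan_iff_apply_eq_zero (hν x (a q * x + b q)) (hnc q hqU r hrU hqr)
      ((hon q hqU _ _).1 rfl) ((hon r hrU _ _).1 (by linarith)) z
    rw [hon z hz, ← hiff, ← SetLike.mem_coe (A := AffineSubspace ℝ Pt3), ← hPeq, ← Finset.mem_coe, hTP]
    exact and_iff_right (Finset.mem_of_mem_erase hz)
  choose! f hf using hex
  have hfinj : Set.InjOn f ((planeTraces S).filter (p ∈ ·)) := by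
    intro T hT T' hT' heq
    have h1 := hf T hT
    have h2 := hf T' hT'
    rw [Finset.mem_coe, Finset.mem_filter] at hT hT'
    ext z
    by_cases hzp : z = p
    · subst hzp
      exact iff_of_true hT.2 hT'.2
    · by_cases hzS : z ∈ S
      · have hzU : z ∈ U := Finset.mem_erase.2 ⟨hzp, hzS⟩
        rw [h1 z hzU, h2 z hzU, heq]
      · exact iff_of_false (fun h => hzS (hD.subset T hT.1 h)) fun h => hzS (hD.subset T' hT'.1 h)
  have hmain := sum_card_incidences_le U (((planeTraces S).filter (p ∈ ·)).image f) a b hinj (by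
    intro q hq r hr hqr v hvq hvr
    have hne : q ≠ r := fun h => hqr (by rw [h])
    have hq' := Finset.mem_erase.1 hq
    have hr' := Finset.mem_erase.1 hr
    obtain ⟨T, hT, hsub⟩ := hD.exists_superset {p, q, r}
      (by simp [Finset.insert_subset_iff, hp, hq'.2, hr'.2])
      (Finset.card_eq_three.2 ⟨p, q, r, hq'.1.symm, hr'.1.symm, hne, rfl⟩)
    simp only [Finset.insert_subset_iff, Finset.singleton_subset_iff] at hsub
    have hT' : T ∈ (planeTraces S).filter (p ∈ ·) := Finset.mem_filter.2 ⟨hT, hsub.1⟩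
    refine Finset.mem_image.2 ⟨T, hT', ?_⟩
    exact huniq q hq r hr hne _ _ ((hf T hT' q hq).1 hsub.2.1) ((hf T hT' r hr).1 hsub.2.2) hvq hvr)
  rw [Finset.sum_image hfinj, Finset.card_image_of_injOn hfinj, hU,
    Finset.card_erase_of_mem hp, ← hU] at hmain
  refine le_trans (le_of_eq (Finset.sum_congr rfl fun T hT => ?_)) hmain
  have hT' := Finset.mem_filter.1 hT
  rw [← Finset.card_erase_of_mem hT'.2]
  congr 1
  ext z
  rw [Finset.mem_filter]
  constructor
  · intro hz
    have hzU : z ∈ U := Finset.erase_subset_erase p (hD.subset T hT'.1) hz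
    exact ⟨hzU, (hf T hT z hzU).1 (Finset.mem_of_mem_erase hz)⟩
  · rintro ⟨hzU, hz⟩
    exact Finset.mem_erase.2 ⟨(Finset.mem_erase.1 hzU).1, (hf T hT z hzU).2 hz⟩

theorem stmt15 (S : Set Pt3) (hS : S.Finite) (n : ℕ) (hn : S.ncard = n)
    (hn59 : 59 ≤ n) (h3 : NoThreeCollinear S) (hpl : ¬ Coplanar ℝ S) :
    ((detPlanes S).ncard : ℤ) - ((detLines3 S).ncard : ℤ) + n ≥ 2 := by
  classical
  lift S to Finset Pt3 using hS
  rw [Set.ncard_coe_finset] at hn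
  subst hn
  have hSB : S ∉ planeTraces S := by
    intro h
    obtain ⟨P, hP, hSP⟩ := mem_planeTraces.1 h
    exact hpl (hP.1.coplanar.subset (Set.inter_eq_left.1 hSP.symm))
  have h1 := (isTripleDesign_planeTraces h3).choose_two_le hn59 hSB fun p hp => by
    convert sum_card_planeTraces_le h3 hp
  have h2 := card_planeTraces_le_ncard h3
  have h4 := ncard_detLines3_le S
  omega
end
end

section
/- Let S be a set of n ≥ 5 points in ℝ³, not all cospherical, not all coplanar, with no four points cocircular and no three points collinear. Then the number of spheres containing exactly four points of S is at least (9/208)·C(n,3). -/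
open Set

noncomputable section

/-- A sphere in space: a metric sphere of positive radius. -/
def IsSphere (C : Set Pt3) : Prop :=
  ∃ (o : Pt3) (ρ : ℝ), 0 < ρ ∧ C = Metric.sphere o ρ

/-- `sphereCount S r` is the number of spheres containing exactly `r` points of `S`. -/
def sphereCount (S : Set Pt3) (r : ℕ) : ℕ :=
  {C : Set Pt3 | IsSphere C ∧ (S ∩ C).ncard = r}.ncard

/-- No four points of `S` are cocircular. -/
def NoFourConcyclic (S : Set Pt3) : Prop :=
  ∀ T ⊆ S, T.ncard = 4 → ¬ EuclideanGeometry.Concyclic T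

open scoped Classical in
theorem exists_third {ι : Type*} {B : Finset ι} {i j : ι} (hi : i ∈ B) (hj : j ∈ B) (hij : i ≠ j)
    (hB : B.card ≠ 2) : ∃ k ∈ B, k ≠ i ∧ k ≠ j := by
  by_contra! h
  apply hB
  have : B = {i, j} := by
    ext k
    simp only [Finset.mem_insert, Finset.mem_singleton]
    constructor
    · intro hk
      by_cases hki : k = i
      · exact Or.inl hki
      · exact Or.inr (h k hk hki)
    · rintro (rfl | rfl) <;> assumption
  rw [this, Finset.card_pair hij]

open scoped Classical in
theorem exists_ordinary_near {X ι : Type*} (A : Finset ι) (On : ι → X → Prop) (m : ι) (hmA : m ∈ A)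
    (f g : X → ℝ) (hsurj : ∀ h t, ∃ P, f P = h ∧ g P = t)
    (hm : ∀ P, On m P ↔ f P = 0)
    (htype : ∀ i ∈ A, i ≠ m → (∃ α β, ∀ P, On i P ↔ g P = α + β * f P) ∨
      (∃ k, k ≠ 0 ∧ ∀ P, On i P ↔ f P = k))
    (hss : ∀ i ∈ A, ∀ j ∈ A, i ≠ j → ∀ P Q, On i P → On j P → On i Q → On j Q → P = Q)
    (hconc : ¬ ∃ P, ∀ i ∈ A, On i P) (hpar : ∃ i ∈ A, i ≠ m ∧ ∃ P, On i P ∧ On m P) :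
    ∃ V, (A.filter (On · V)).card = 2 ∧ (On m V ∨ (f V ≠ 0 ∧
      ∀ Y, ∀ i ∈ A, ∀ j ∈ A, i ≠ j → On i Y → On j Y → ¬ (0 < f Y * f V ∧ f Y * f V < f V ^ 2))) := by
  by_contra! hcon
  -- every point of `m` on another line lies on a third line
  have hthird : ∀ i ∈ A, i ≠ m → ∀ P, On i P → On m P →
      ∃ c ∈ A, c ≠ m ∧ c ≠ i ∧ On c P := by
    intro i hi him P hiP hmP
    have h2 : (A.filter (On · P)).card ≠ 2 := fun h => (hcon P h).1 hmP
    obtain ⟨c, hc, h1, h3⟩ := exists_third (i := m) (j := i) (by simp [hmA, hmP])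
      (by simp [hi, hiP]) (Ne.symm him) h2
    simp only [Finset.mem_filter] at hc
    exact ⟨c, hc.1, h1, h3, hc.2⟩
  have htrans : ∀ i ∈ A, i ≠ m → ∀ P, On i P → On m P →
      ∃ α β, ∀ P, On i P ↔ g P = α + β * f P := by
    intro i hi him P hiP hmP
    rcases htype i hi him with h | ⟨k, hk, h⟩
    · exact h
    · exact absurd (((h P).1 hiP).symm.trans ((hm P).1 hmP)) hk
  set W : Set X := {P | f P ≠ 0 ∧ ∃ i ∈ A, ∃ j ∈ A, i ≠ j ∧ On i P ∧ On j P} with hW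
  have hWfin : W.Finite := by
    have : W ⊆ ⋃ i ∈ (A : Set ι), ⋃ j ∈ (A : Set ι), {P | i ≠ j ∧ On i P ∧ On j P} := by
      rintro P ⟨-, i, hi, j, hj, h⟩
      simp only [Set.mem_iUnion]
      exact ⟨i, hi, j, hj, h⟩
    refine Set.Finite.subset ?_ this
    refine A.finite_toSet.biUnion fun i hi => A.finite_toSet.biUnion fun j hj => ?_
    apply Set.Subsingleton.finite
    rintro P ⟨hij, h1, h2⟩ Q ⟨-, h3, h4⟩
    exact hss i hi j hj hij P Q h1 h2 h3 h4
  have hWne : W.Nonempty := by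
    obtain ⟨i, hi, him, P, hiP, hmP⟩ := hpar
    obtain ⟨c, hc, hcm, hci, hcP⟩ := hthird i hi him P hiP hmP
    obtain ⟨α, β, h⟩ := htrans i hi him P hiP hmP
    obtain ⟨α', β', h'⟩ := htrans c hc hcm P hcP hmP
    have hP0 := (hm P).1 hmP
    have e1 := (h P).1 hiP
    have e2 := (h' P).1 hcP
    rw [hP0] at e1 e2
    have hββ : β ≠ β' := by
      rintro rfl
      obtain ⟨Q, hQ1, hQ2⟩ := hsurj 1 (α + β)
      have := hss i hi c hc hci.symm P Q hiP hcP ((h Q).2 (by rw [hQ1, hQ2]; ring))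
        ((h' Q).2 (by rw [hQ1, hQ2]; linarith))
      rw [this, hQ1] at hP0
      exact one_ne_zero hP0
    obtain ⟨k, hk, hkP⟩ : ∃ k ∈ A, ¬ On k P := by
      by_contra! h
      exact hconc ⟨P, h⟩
    have hkm : k ≠ m := by rintro rfl; exact hkP hmP
    have hcross : ∀ γ δ, (∀ P, On k P ↔ g P = γ + δ * f P) → ∀ i ∈ A, i ≠ k → On i P →
        ∀ α β, (∀ P, On i P ↔ g P = α + β * f P) → δ ≠ β → W.Nonempty := by
      intro γ δ hγ i hi hik hiP α β h hne
      have e1 := (h P).1 hiP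
      obtain ⟨Q, hQ1, hQ2⟩ := hsurj ((α - γ) / (δ - β)) (α + β * ((α - γ) / (δ - β)))
      have hs : δ - β ≠ 0 := sub_ne_zero.2 hne
      have hαγ : α - γ ≠ 0 := by
        intro h0
        apply hkP
        rw [hγ, e1, hP0]
        linarith
      refine ⟨Q, ?_, i, hi, k, hk, hik, (h Q).2 (by rw [hQ1, hQ2]), (hγ Q).2 ?_⟩
      · rw [hQ1]; exact div_ne_zero hαγ hs
      · rw [hQ1, hQ2]; field_simp; ring
    have hik : i ≠ k := by rintro rfl; exact hkP hiP
    have hck : c ≠ k := by rintro rfl; exact hkP hcP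
    rcases htype k hk hkm with ⟨γ, δ, hγ⟩ | ⟨z, hz, hzk⟩
    · by_cases hδ : δ = β
      · exact hcross γ δ hγ c hc hck hcP α' β' h' (by rw [hδ]; exact hββ)
      · exact hcross γ δ hγ i hi hik hiP α β h hδ
    · obtain ⟨Q, hQ1, hQ2⟩ := hsurj z (α + β * z)
      exact ⟨Q, by rw [hQ1]; exact hz, i, hi, k, hk, hik, (h Q).2 (by rw [hQ1, hQ2]),
        (hzk Q).2 hQ1⟩
  obtain ⟨V₀, hV₀, hmin₀⟩ := Set.exists_min_image W (fun P => |f P|) hWfin hWne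
  obtain ⟨V, ⟨hVW, hV0⟩, hming⟩ := Set.exists_min_image (W ∩ {P | f P = f V₀}) g
    (hWfin.subset inter_subset_left) ⟨V₀, hV₀, rfl⟩
  have hmin : ∀ P ∈ W, |f V| ≤ |f P| := by
    intro P hP
    rw [show f V = f V₀ from hV0]
    exact hmin₀ P hP
  have hleft : ∀ P ∈ W, f P = f V → g V ≤ g P := fun P hP h =>
    hming P ⟨hP, h.trans hV0⟩
  obtain ⟨hfV, i, hi, j, hj, hij, hiV, hjV⟩ := hVW
  have hempty : ∀ Y, ∀ i ∈ A, ∀ j ∈ A, i ≠ j → On i Y → On j Y →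
      ¬ (0 < f Y * f V ∧ f Y * f V < f V ^ 2) := by
    rintro Y i hi j hj hij hiY hjY ⟨h1, h2⟩
    have hY0 : f Y ≠ 0 := by
      intro h; rw [h] at h1; simp at h1
    have := hmin Y ⟨hY0, i, hi, j, hj, hij, hiY, hjY⟩
    have h3 : |f Y| * |f V| < |f V| * |f V| := by
      rw [← abs_mul, abs_of_pos h1, abs_mul_abs_self]; linarith [sq (f V)]
    have := lt_of_mul_lt_mul_right h3 (abs_nonneg _)
    linarith
  have hne2 : (A.filter (On · V)).card ≠ 2 := by
    intro h
    obtain ⟨Y, i, hi, j, hj, hij, h1, h2, h3⟩ := (hcon V h).2 hfV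
    exact hempty Y i hi j hj hij h1 h2 h3
  obtain ⟨k, hk, hki, hkj⟩ := exists_third (i := i) (j := j) (by simp [hi, hiV])
      (by simp [hj, hjV]) hij hne2
  simp only [Finset.mem_filter] at hk
  obtain ⟨hk, hkV⟩ := hk
  have hVm : ∀ i, On i V → i ≠ m := by
    rintro i hiV rfl
    exact hfV ((hm V).1 hiV)
  -- two transversals through `V` have different feet on `m`
  have hfeet : ∀ i ∈ A, ∀ j ∈ A, i ≠ j → ∀ α β γ δ, (∀ P, On i P ↔ g P = α + β * f P) →
      (∀ P, On j P ↔ g P = γ + δ * f P) → On i V → On j V → α ≠ γ := by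
    rintro i hi j hj hij α β γ δ h1 h2 hiV hjV rfl
    obtain ⟨Q, hQ1, hQ2⟩ := hsurj 0 α
    have := hss i hi j hj hij V Q hiV hjV ((h1 Q).2 (by rw [hQ1, hQ2]; ring))
      ((h2 Q).2 (by rw [hQ1, hQ2]; ring))
    rw [this] at hfV
    exact hfV hQ1
  -- two transversals cannot cross strictly between `m` and `V`
  have hnocross : ∀ c ∈ A, ∀ j ∈ A, c ≠ j → ∀ α β γ δ, (∀ P, On c P ↔ g P = α + β * f P) →
      (∀ P, On j P ↔ g P = γ + δ * f P) →
      ¬ ((α - γ) * ((α + β * f V) - (γ + δ * f V)) < 0) := by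
    intro c hc j hj hcj α β γ δ h1 h2 hlt
    have hβδ : β ≠ δ := by
      rintro rfl
      nlinarith [sq_nonneg (α - γ)]
    have hs : β - δ ≠ 0 := sub_ne_zero.2 hβδ
    obtain ⟨Q, hQ1, hQ2⟩ := hsurj ((γ - α) / (β - δ)) (α + β * ((γ - α) / (β - δ)))
    refine hempty Q c hc j hj hcj ((h1 Q).2 (by rw [hQ1, hQ2]))
      ((h2 Q).2 (by rw [hQ1, hQ2]; field_simp; ring)) ?_
    rw [hQ1]
    set s := (γ - α) / (β - δ) with hsdef
    have hγα : γ - α = s * (β - δ) := by rw [hsdef]; field_simp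
    have h3 : (β - δ) ^ 2 * (s * (f V - s)) > 0 := by
      have : (α - γ) * ((α + β * f V) - (γ + δ * f V)) = -((β - δ) ^ 2 * (s * (f V - s))) := by
        have e : α - γ = - (s * (β - δ)) := by linarith
        have e' : (α + β * f V) - (γ + δ * f V) = (α - γ) + (β - δ) * f V := by ring
        rw [e', e]; ring
      linarith
    have h4 : 0 < s * (f V - s) := by
      by_contra h
      push Not at h
      nlinarith [mul_nonneg (sq_nonneg (β - δ)) (neg_nonneg.2 h)]
    constructor
    · nlinarith [sq_nonneg s]
    · have : 0 < (f V - s) ^ 2 + s * (f V - s) := by positivity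
      nlinarith
  -- a third line through the foot of `j` passes `V` on the same side as the foot
  have hside : ∀ j ∈ A, On j V → ∀ γ δ, (∀ P, On j P ↔ g P = γ + δ * f P) →
      ∃ c ∈ A, c ≠ j ∧ ∃ δ', (∀ P, On c P ↔ g P = γ + δ' * f P) ∧ γ + δ' * f V ≠ g V ∧
      ∀ k ∈ A, On k V → ∀ α β, (∀ P, On k P ↔ g P = α + β * f P) →
        0 ≤ (γ - α) * (γ + δ' * f V - g V) := by
    intro j hj hjV γ δ h1
    obtain ⟨P, hP1, hP2⟩ := hsurj 0 γ
    have hjP : On j P := (h1 P).2 (by rw [hP1, hP2]; ring)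
    obtain ⟨c, hc, hcm, hcj, hcP⟩ := hthird j hj (hVm j hjV) P hjP ((hm P).2 hP1)
    obtain ⟨γ', δ', h2⟩ := htrans c hc hcm P hcP ((hm P).2 hP1)
    have : γ' = γ := by
      have := (h2 P).1 hcP
      rw [hP1, hP2] at this
      linarith
    subst this
    have hcV : ¬ On c V := by
      intro hcV
      exact hfeet c hc j hj hcj _ _ _ _ h2 h1 hcV hjV rfl
    refine ⟨c, hc, hcj, δ', h2, fun h => hcV ((h2 V).2 h.symm), ?_⟩
    intro k hk hkV α β h3
    have hck : c ≠ k := by rintro rfl; exact hcV hkV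
    have := hnocross c hc k hk hck _ _ _ _ h2 h3
    rw [← (h3 V).1 hkV] at this
    exact not_lt.1 this
  -- a line through `V` parallel to `m` cannot coexist with two transversals
  have hnopar : ∀ i ∈ A, ∀ j ∈ A, i ≠ j → On i V → On j V → ∀ α β γ δ,
      (∀ P, On i P ↔ g P = α + β * f P) → (∀ P, On j P ↔ g P = γ + δ * f P) →
      ∀ k ∈ A, On k V → ¬ ∃ z, z ≠ 0 ∧ ∀ P, On k P ↔ f P = z := by
    intro i hi j hj hij hiV hjV α β γ δ h1 h2 k hk hkV
    have key : ∀ i ∈ A, ∀ j ∈ A, On i V → On j V → ∀ α β γ δ,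
      (∀ P, On i P ↔ g P = α + β * f P) → (∀ P, On j P ↔ g P = γ + δ * f P) → α < γ →
      ¬ ∃ z, z ≠ 0 ∧ ∀ P, On k P ↔ f P = z := by
      rintro i hi j hj hiV hjV α β γ δ h1 h2 hlt ⟨z, hz, hkz⟩
      obtain ⟨c, hc, hci, δ', hcδ, hne, hs⟩ := hside i hi hiV α β h1
      have h5 := hs j hj hjV γ δ h2
      obtain ⟨Q, hQ1, hQ2⟩ := hsurj (f V) (α + δ' * f V)
      have hzV := (hkz V).1 hkV
      have hckne : c ≠ k := by
        rintro rfl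
        have h6 := (hkz V).1 hkV
        obtain ⟨R, hR1, hR2⟩ := hsurj 0 α
        have := (hkz R).1 ((hcδ R).2 (by rw [hR1, hR2]; ring))
        exact hz (this.symm.trans hR1)
      have := hleft Q ⟨by rw [hQ1]; exact hfV, c, hc, k, hk, hckne, (hcδ Q).2 (by rw [hQ1, hQ2]),
        (hkz Q).2 (hQ1.trans hzV)⟩ hQ1
      rw [hQ2] at this
      have h7 : g V < α + δ' * f V := lt_of_le_of_ne this (Ne.symm hne)
      nlinarith
    rcases lt_or_gt_of_ne (hfeet i hi j hj hij _ _ _ _ h1 h2 hiV hjV) with h | h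
    · exact key i hi j hj hiV hjV _ _ _ _ h1 h2 h
    · exact key j hj i hi hjV hiV _ _ _ _ h2 h1 h
  have hparuniq : ∀ i ∈ A, ∀ j ∈ A, i ≠ j → On i V → On j V →
      (∃ z, z ≠ 0 ∧ ∀ P, On i P ↔ f P = z) → (∃ z, z ≠ 0 ∧ ∀ P, On j P ↔ f P = z) → False := by
    rintro i hi j hj hij hiV hjV ⟨z, -, h1⟩ ⟨w, -, h2⟩
    obtain ⟨Q, hQ1, hQ2⟩ := hsurj (f V) (g V + 1)
    have := hss i hi j hj hij V Q hiV hjV ((h1 Q).2 (by rw [hQ1]; exact (h1 V).1 hiV))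
      ((h2 Q).2 (by rw [hQ1]; exact (h2 V).1 hjV))
    rw [← this] at hQ2
    linarith
  have hmid : ∀ i ∈ A, ∀ j ∈ A, ∀ k ∈ A, On i V → On j V → On k V → ∀ α β γ δ ε ζ,
      (∀ P, On i P ↔ g P = α + β * f P) → (∀ P, On j P ↔ g P = γ + δ * f P) →
      (∀ P, On k P ↔ g P = ε + ζ * f P) → α < γ → γ < ε → False := by
    intro i hi j hj k hk hiV hjV hkV α β γ δ ε ζ h1 h2 h3 hl1 hl2
    obtain ⟨c, hc, hcj, δ', hcδ, hne, hs⟩ := hside j hj hjV γ δ h2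
    have h5 := hs i hi hiV _ _ h1
    have h6 := hs k hk hkV _ _ h3
    rcases lt_or_gt_of_ne hne with h | h <;> nlinarith
  rcases htype i hi (hVm i hiV) with ⟨α, β, h1⟩ | h1 <;>
  rcases htype j hj (hVm j hjV) with ⟨γ, δ, h2⟩ | h2 <;>
  rcases htype k hk (hVm k hkV) with ⟨ε, ζ, h3⟩ | h3
  · have n1 := hfeet i hi j hj hij _ _ _ _ h1 h2 hiV hjV
    have n2 := hfeet k hk i hi hki _ _ _ _ h3 h1 hkV hiV
    have n3 := hfeet k hk j hj hkj _ _ _ _ h3 h2 hkV hjV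
    rcases lt_or_gt_of_ne n1 with l1 | l1 <;> rcases lt_or_gt_of_ne n2 with l2 | l2 <;>
      rcases lt_or_gt_of_ne n3 with l3 | l3
    · exact hmid k hk i hi j hj hkV hiV hjV _ _ _ _ _ _ h3 h1 h2 l2 l1
    · linarith
    · exact hmid i hi k hk j hj hiV hkV hjV _ _ _ _ _ _ h1 h3 h2 l2 l3
    · exact hmid i hi j hj k hk hiV hjV hkV _ _ _ _ _ _ h1 h2 h3 l1 l3
    · exact hmid k hk j hj i hi hkV hjV hiV _ _ _ _ _ _ h3 h2 h1 l3 l1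
    · exact hmid j hj k hk i hi hjV hkV hiV _ _ _ _ _ _ h2 h3 h1 l3 l2
    · linarith
    · exact hmid j hj i hi k hk hjV hiV hkV _ _ _ _ _ _ h2 h1 h3 l1 l2
  · exact hnopar i hi j hj hij hiV hjV _ _ _ _ h1 h2 k hk hkV h3
  · exact hnopar i hi k hk hki.symm hiV hkV _ _ _ _ h1 h3 j hj hjV h2
  · exact hparuniq j hj k hk hkj.symm hjV hkV h2 h3
  · exact hnopar j hj k hk hkj.symm hjV hkV _ _ _ _ h2 h3 i hi hiV h1
  · exact hparuniq i hi k hk hki.symm hiV hkV h1 h3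
  · exact hparuniq i hi j hj hij hiV hjV h1 h2
  · exact hparuniq i hi j hj hij hiV hjV h1 h2

/-- The value at `P` of the affine form `a x + b y - c` with coefficients `(a, b, c)`. -/
def lineEval (l : ℝ × ℝ × ℝ) (P : ℝ × ℝ) : ℝ := l.1 * P.1 + l.2.1 * P.2 - l.2.2

/-- The determinant of the linear parts of two affine forms. -/
def lineDet (l l' : ℝ × ℝ × ℝ) : ℝ := l.1 * l'.2.1 - l'.1 * l.2.1

/-- The point reached from `V` by moving `s` times the direction vector of `l`. -/
def lineShift (l : ℝ × ℝ × ℝ) (V : ℝ × ℝ) (s : ℝ) : ℝ × ℝ := (V.1 - s * l.2.1, V.2 + s * l.1)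

theorem lineEval_lineShift (l l' : ℝ × ℝ × ℝ) (V : ℝ × ℝ) (s : ℝ) :
    lineEval l' (lineShift l V s) = lineEval l' V + s * lineDet l l' := by
  simp only [lineEval, lineShift, lineDet]; ring

theorem lineDet_self (l : ℝ × ℝ × ℝ) : lineDet l l = 0 := sub_self _

theorem lineShift_injective {l : ℝ × ℝ × ℝ} (hl : l.1 ≠ 0 ∨ l.2.1 ≠ 0) {V : ℝ × ℝ} {s t : ℝ}
    (h : lineShift l V s = lineShift l V t) : s = t := by
  simp only [lineShift, Prod.mk.injEq, sub_right_inj, add_right_inj] at h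
  rcases hl with hl | hl
  · exact mul_right_cancel₀ hl h.2
  · exact mul_right_cancel₀ hl h.1

theorem sq_add_sq_pos {l : ℝ × ℝ × ℝ} (hl : l.1 ≠ 0 ∨ l.2.1 ≠ 0) : 0 < l.1 ^ 2 + l.2.1 ^ 2 := by
  rcases hl with hl | hl <;> positivity

theorem lineDet_eq_zero_of_common {l l' m : ℝ × ℝ × ℝ} (hm : m.1 ≠ 0 ∨ m.2.1 ≠ 0)
    (h : lineDet l m = 0) (h' : lineDet l' m = 0) : lineDet l l' = 0 := by
  simp only [lineDet] at *
  rcases hm with hm | hm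
  · apply mul_left_cancel₀ hm
    linear_combination l'.1 * h - l.1 * h'
  · apply mul_left_cancel₀ hm
    linear_combination l'.2.1 * h - l.2.1 * h'

/-- `V` is attached to the line `m`: it lies off `m`, and no point on two lines of the family lies
strictly between `m` and the parallel to `m` through `V`. -/
def Attached {ι : Type*} (A : Finset ι) (L : ι → ℝ × ℝ × ℝ) (m : ι) (V : ℝ × ℝ) : Prop :=
  lineEval (L m) V ≠ 0 ∧ ∀ Y, ∀ i ∈ A, ∀ j ∈ A, i ≠ j → lineEval (L i) Y = 0 →
    lineEval (L j) Y = 0 → ¬ (0 < lineEval (L m) Y * lineEval (L m) V ∧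
      lineEval (L m) Y * lineEval (L m) V < lineEval (L m) V ^ 2)

section Arrangement

variable {ι : Type*} {A : Finset ι} {L : ι → ℝ × ℝ × ℝ}

theorem exists_ordinary_of_line (hL : ∀ i ∈ A, (L i).1 ≠ 0 ∨ (L i).2.1 ≠ 0)
    (hss : ∀ i ∈ A, ∀ j ∈ A, i ≠ j → ∀ P Q, lineEval (L i) P = 0 → lineEval (L j) P = 0 →
      lineEval (L i) Q = 0 → lineEval (L j) Q = 0 → P = Q)
    (hconc : ¬ ∃ P, ∀ i ∈ A, lineEval (L i) P = 0)
    (hpar : ∃ i ∈ A, ∃ j ∈ A, lineDet (L i) (L j) ≠ 0) (m : ι) (hm : m ∈ A) :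
    ∃ V, (A.filter fun i => lineEval (L i) V = 0).card = 2 ∧
      (lineEval (L m) V = 0 ∨ Attached A L m V) := by
  have hn := sq_add_sq_pos (hL m hm)
  have hn' := hn.ne'
  have hsurj : ∀ h t, ∃ P : ℝ × ℝ, lineEval (L m) P = h ∧
      -(L m).2.1 * P.1 + (L m).1 * P.2 = t := by
    intro h t
    refine ⟨(((L m).1 * (h + (L m).2.2) - (L m).2.1 * t) / ((L m).1 ^ 2 + (L m).2.1 ^ 2),
      ((L m).2.1 * (h + (L m).2.2) + (L m).1 * t) / ((L m).1 ^ 2 + (L m).2.1 ^ 2)), ?_, ?_⟩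
    · simp only [lineEval]; field_simp; ring
    · field_simp; ring
  have := exists_ordinary_near A (fun i P => lineEval (L i) P = 0) m hm (lineEval (L m))
    (fun P => -(L m).2.1 * P.1 + (L m).1 * P.2) hsurj (fun P => Iff.rfl) ?_ hss hconc ?_
  · obtain ⟨V, h1, h2⟩ := this
    refine ⟨V, ?_, h2⟩
    convert h1
  · intro i hi him
    by_cases hD : lineDet (L i) (L m) = 0
    · right
      obtain ⟨r, hr1, hr2⟩ : ∃ r, (L i).1 = r * (L m).1 ∧ (L i).2.1 = r * (L m).2.1 := by
        refine ⟨((L i).1 * (L m).1 + (L i).2.1 * (L m).2.1) / ((L m).1 ^ 2 + (L m).2.1 ^ 2), ?_, ?_⟩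
        · simp only [lineDet] at hD
          field_simp
          linear_combination (L m).2.1 * hD
        · simp only [lineDet] at hD
          field_simp
          linear_combination -(L m).1 * hD
      have hr : r ≠ 0 := by
        rintro rfl
        rcases hL i hi with h | h <;> simp_all
      have hiff : ∀ P, lineEval (L i) P = 0 ↔
          lineEval (L m) P = (L i).2.2 / r - (L m).2.2 := by
        intro P
        simp only [lineEval, hr1, hr2]
        rw [eq_sub_iff_add_eq, eq_div_iff hr, sub_eq_zero]
        constructor <;> intro h <;> linear_combination h
      refine ⟨(L i).2.2 / r - (L m).2.2, ?_, hiff⟩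
      intro h0
      rw [h0] at hiff
      obtain ⟨P, hP, -⟩ := hsurj 0 0
      have hQ : lineEval (L m) (lineShift (L m) P 1) = 0 := by
        rw [lineEval_lineShift, hP, lineDet_self]; ring
      have := hss i hi m hm him P (lineShift (L m) P 1) ((hiff _).2 hP) hP ((hiff _).2 hQ) hQ
      have h2 : lineShift (L m) P 0 = lineShift (L m) P 1 := by
        rw [← this]; simp [lineShift]
      exact zero_ne_one (lineShift_injective (hL m hm) h2)
    · left
      refine ⟨((L m).2.2 * ((L i).1 * (L m).1 + (L i).2.1 * (L m).2.1) -
        (L i).2.2 * ((L m).1 ^ 2 + (L m).2.1 ^ 2)) / lineDet (L i) (L m),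
        ((L i).1 * (L m).1 + (L i).2.1 * (L m).2.1) / lineDet (L i) (L m), ?_⟩
      intro P
      have e : ∀ x y z : ℝ, x / lineDet (L i) (L m) + y / lineDet (L i) (L m) * z =
        (x + y * z) / lineDet (L i) (L m) := by intros; field_simp
      rw [e, eq_div_iff hD]
      simp only [lineEval, lineDet]
      constructor
      · intro h
        linear_combination -((L m).1 ^ 2 + (L m).2.1 ^ 2) * h
      · intro h
        apply mul_left_cancel₀ hn'
        linear_combination -h
  · obtain ⟨i, hi, hD⟩ : ∃ i ∈ A, lineDet (L i) (L m) ≠ 0 := by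
      by_contra! h
      obtain ⟨i, hi, j, hj, hij⟩ := hpar
      exact hij (lineDet_eq_zero_of_common (hL m hm) (h i hi) (h j hj))
    refine ⟨i, hi, ?_, (((L i).2.2 * (L m).2.1 - (L m).2.2 * (L i).2.1) / lineDet (L i) (L m),
      ((L i).1 * (L m).2.2 - (L m).1 * (L i).2.2) / lineDet (L i) (L m)), ?_, ?_⟩
    · rintro rfl; exact hD (lineDet_self _)
    · simp only [lineEval]; field_simp; simp only [lineDet]; ring
    · simp only [lineEval]; field_simp; simp only [lineDet]; ring

theorem shift_param_eq_of_attached {m m' i : ι} {V : ℝ × ℝ} (hi : i ∈ A) (hm : m ∈ A) (hm' : m' ∈ A)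
    (hiV : lineEval (L i) V = 0) (h : Attached A L m V) (h' : Attached A L m' V)
    (hs : SignType.sign (lineEval (L m) V * lineDet (L i) (L m)) =
      SignType.sign (lineEval (L m') V * lineDet (L i) (L m')))
    (hD : lineDet (L i) (L m) ≠ 0) :
    ∃ s, s ≠ 0 ∧ lineEval (L m) (lineShift (L i) V s) = 0 ∧
      lineEval (L m') (lineShift (L i) V s) = 0 := by
  have hD' : lineDet (L i) (L m') ≠ 0 := by
    intro h0
    rw [h0, mul_zero, sign_zero, sign_eq_zero_iff] at hs
    exact mul_ne_zero h.1 hD hs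
  have key : ∀ m m' : ι, m' ∈ A → Attached A L m V → Attached A L m' V →
      ∀ s t : ℝ, lineEval (L m) V + s * lineDet (L i) (L m) = 0 →
      lineEval (L m') V + t * lineDet (L i) (L m') = 0 → 0 < s * t → s ^ 2 ≤ s * t := by
    intro m m' hm' h h' s t hs ht hst
    by_contra! hlt
    have him' : i ≠ m' := by rintro rfl; exact h'.1 hiV
    refine h.2 (lineShift (L i) V t) i hi m' hm' him' ?_ ?_ ?_
    · rw [lineEval_lineShift, hiV, lineDet_self]; ring
    · rw [lineEval_lineShift, ht]
    · rw [lineEval_lineShift]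
      have e : lineEval (L m) V = - (s * lineDet (L i) (L m)) := by linarith
      have hd : 0 < lineDet (L i) (L m) ^ 2 := by
        have : lineDet (L i) (L m) ≠ 0 := by
          intro h0; rw [h0] at e; exact h.1 (by rw [e]; ring)
        positivity
      rw [e]
      constructor
      · have := mul_pos hd (sub_pos.2 hlt); nlinarith
      · have := mul_pos hd hst; nlinarith
  set s := -lineEval (L m) V / lineDet (L i) (L m) with hsd
  set t := -lineEval (L m') V / lineDet (L i) (L m') with htd
  have e1 : lineEval (L m) V + s * lineDet (L i) (L m) = 0 := by rw [hsd]; field_simp; ring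
  have e2 : lineEval (L m') V + t * lineDet (L i) (L m') = 0 := by rw [htd]; field_simp; ring
  have hs0 : s ≠ 0 := div_ne_zero (neg_ne_zero.2 h.1) hD
  have ht0 : t ≠ 0 := div_ne_zero (neg_ne_zero.2 h'.1) hD'
  have hst : 0 < s * t := by
    have f1 : lineEval (L m) V = -(s * lineDet (L i) (L m)) := by linarith
    have f2 : lineEval (L m') V = -(t * lineDet (L i) (L m')) := by linarith
    have hd : 0 < lineDet (L i) (L m) ^ 2 := by positivity
    have hd' : 0 < lineDet (L i) (L m') ^ 2 := by positivity
    have g1 : lineEval (L m) V * lineDet (L i) (L m) = -s * lineDet (L i) (L m) ^ 2 := by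
      rw [f1]; ring
    have g2 : lineEval (L m') V * lineDet (L i) (L m') = -t * lineDet (L i) (L m') ^ 2 := by
      rw [f2]; ring
    rw [g1, g2, sign_mul, sign_mul, sign_pos hd, sign_pos hd', mul_one, mul_one] at hs
    rcases lt_or_gt_of_ne hs0 with hs1 | hs1
    · rw [sign_pos (neg_pos.2 hs1), eq_comm, sign_eq_one_iff] at hs
      nlinarith
    · rw [sign_neg (neg_neg_of_pos hs1), eq_comm, sign_eq_neg_one_iff] at hs
      nlinarith
  have k1 := key m m' hm' h h' s t e1 e2 hst
  have k2 := key m' m hm h' h t s e2 e1 (by linarith)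
  have hst' : s = t := by
    have : (s - t) ^ 2 ≤ 0 := by nlinarith
    have := pow_eq_zero_iff two_ne_zero |>.1 (le_antisymm this (sq_nonneg _))
    linarith
  refine ⟨s, hs0, ?_, ?_⟩
  · rw [lineEval_lineShift, e1]
  · rw [lineEval_lineShift, hst', e2]

theorem eq_of_attached (hL : ∀ i ∈ A, (L i).1 ≠ 0 ∨ (L i).2.1 ≠ 0)
    (hss : ∀ i ∈ A, ∀ j ∈ A, i ≠ j → ∀ P Q, lineEval (L i) P = 0 → lineEval (L j) P = 0 →
      lineEval (L i) Q = 0 → lineEval (L j) Q = 0 → P = Q)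
    {m m' i j : ι} {V : ℝ × ℝ} (hi : i ∈ A) (hj : j ∈ A) (hij : i ≠ j) (hm : m ∈ A) (hm' : m' ∈ A)
    (hiV : lineEval (L i) V = 0) (hjV : lineEval (L j) V = 0)
    (h : Attached A L m V) (h' : Attached A L m' V)
    (hsi : SignType.sign (lineEval (L m) V * lineDet (L i) (L m)) =
      SignType.sign (lineEval (L m') V * lineDet (L i) (L m')))
    (hsj : SignType.sign (lineEval (L m) V * lineDet (L j) (L m)) =
      SignType.sign (lineEval (L m') V * lineDet (L j) (L m'))) : m = m' := by
  by_contra hne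
  have hmixed : ∀ i ∈ A, ∀ j ∈ A, lineEval (L j) V = 0 →
      SignType.sign (lineEval (L m) V * lineDet (L i) (L m)) =
        SignType.sign (lineEval (L m') V * lineDet (L i) (L m')) →
      SignType.sign (lineEval (L m) V * lineDet (L j) (L m)) =
        SignType.sign (lineEval (L m') V * lineDet (L j) (L m')) →
      lineDet (L i) (L m) = 0 → lineDet (L j) (L m) ≠ 0 → False := by
    intro i hi j hj hjV hsi hsj h0 hD
    have h0' : lineDet (L i) (L m') = 0 := by
      rw [h0, mul_zero, sign_zero, eq_comm, sign_eq_zero_iff] at hsi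
      exact (mul_eq_zero.1 hsi).resolve_left h'.1
    obtain ⟨s, -, h1, h2⟩ := shift_param_eq_of_attached hj hm hm' hjV h h' hsj hD
    have h3 := hss m hm m' hm' hne (lineShift (L j) V s) (lineShift (L i) (lineShift (L j) V s) 1)
      h1 h2 (by rw [lineEval_lineShift, h1, h0]; ring) (by rw [lineEval_lineShift, h2, h0']; ring)
    have h4 : lineShift (L i) (lineShift (L j) V s) 0 =
        lineShift (L i) (lineShift (L j) V s) 1 := by
      rw [← h3]; simp [lineShift]
    exact zero_ne_one (lineShift_injective (hL i hi) h4)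
  have hVshift : ∀ i, lineShift (L i) V 0 = V := by intro i; simp [lineShift]
  by_cases hDi : lineDet (L i) (L m) = 0
  · by_cases hDj : lineDet (L j) (L m) = 0
    · have hD := lineDet_eq_zero_of_common (hL m hm) hDi hDj
      have h3 := hss i hi j hj hij V (lineShift (L i) V 1) hiV hjV
        (by rw [lineEval_lineShift, hiV, lineDet_self]; ring)
        (by rw [lineEval_lineShift, hjV, hD]; ring)
      exact zero_ne_one (lineShift_injective (hL i hi) ((hVshift i).trans h3))
    · exact hmixed i hi j hj hjV hsi hsj hDi hDj
  · by_cases hDj : lineDet (L j) (L m) = 0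
    · exact hmixed j hj i hi hiV hsj hsi hDj hDi
    · obtain ⟨s, hs0, h1, h2⟩ := shift_param_eq_of_attached hi hm hm' hiV h h' hsi hDi
      obtain ⟨t, ht0, h3, h4⟩ := shift_param_eq_of_attached hj hm hm' hjV h h' hsj hDj
      have h5 := hss m hm m' hm' hne _ _ h1 h2 h3 h4
      have h6 := hss i hi j hj hij V (lineShift (L i) V s) hiV hjV
        (by rw [lineEval_lineShift, hiV, lineDet_self]; ring)
        (by rw [h5, lineEval_lineShift, hjV, lineDet_self]; ring)
      exact hs0 (lineShift_injective (hL i hi) (h6.symm.trans (hVshift i).symm))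

theorem finite_ordinary
    (hss : ∀ i ∈ A, ∀ j ∈ A, i ≠ j → ∀ P Q, lineEval (L i) P = 0 → lineEval (L j) P = 0 →
      lineEval (L i) Q = 0 → lineEval (L j) Q = 0 → P = Q) :
    {V | (A.filter fun i => lineEval (L i) V = 0).card = 2}.Finite := by
  have : {V | (A.filter fun i => lineEval (L i) V = 0).card = 2} ⊆ ⋃ i ∈ (A : Set ι),
      ⋃ j ∈ (A : Set ι), {P | i ≠ j ∧ lineEval (L i) P = 0 ∧ lineEval (L j) P = 0} := by
    classical
    intro V hV
    obtain ⟨i, j, hij, h⟩ := Finset.card_eq_two.1 hV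
    have hi : i ∈ A.filter fun i => lineEval (L i) V = 0 := by rw [h]; simp
    have hj : j ∈ A.filter fun i => lineEval (L i) V = 0 := by rw [h]; simp
    simp only [Finset.mem_filter] at hi hj
    simp only [Set.mem_iUnion]
    exact ⟨i, hi.1, j, hj.1, hij, hi.2, hj.2⟩
  refine Set.Finite.subset ?_ this
  refine A.finite_toSet.biUnion fun i hi => A.finite_toSet.biUnion fun j hj => ?_
  apply Set.Subsingleton.finite
  rintro P ⟨hij, h1, h2⟩ Q ⟨-, h3, h4⟩
  exact hss i hi j hj hij P Q h1 h2 h3 h4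

theorem card_lines_le (hL : ∀ i ∈ A, (L i).1 ≠ 0 ∨ (L i).2.1 ≠ 0)
    (hss : ∀ i ∈ A, ∀ j ∈ A, i ≠ j → ∀ P Q, lineEval (L i) P = 0 → lineEval (L j) P = 0 →
      lineEval (L i) Q = 0 → lineEval (L j) Q = 0 → P = Q)
    (hconc : ¬ ∃ P, ∀ i ∈ A, lineEval (L i) P = 0)
    (hpar : ∃ i ∈ A, ∃ j ∈ A, lineDet (L i) (L j) ≠ 0) :
    A.card ≤ 11 * {V | (A.filter fun i => lineEval (L i) V = 0).card = 2}.ncard := by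
  classical
  have hfin := finite_ordinary hss
  rw [Set.ncard_eq_toFinset_card _ hfin]
  choose! F hF1 hF2 using fun m hm => exists_ordinary_of_line hL hss hconc hpar m hm
  refine Finset.card_le_mul_card_image_of_maps_to (f := F) (fun m hm => ?_) _ (fun V hV => ?_)
  · simpa using hF1 m hm
  simp only [Set.Finite.mem_toFinset, Set.mem_ofPred_eq] at hV
  obtain ⟨i, j, hij, h⟩ := Finset.card_eq_two.1 hV
  have hi : i ∈ A.filter fun i => lineEval (L i) V = 0 := by rw [h]; simp
  have hj : j ∈ A.filter fun i => lineEval (L i) V = 0 := by rw [h]; simp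
  simp only [Finset.mem_filter] at hi hj
  have hsub : (A.filter fun m => F m = V) ⊆ (A.filter fun i => lineEval (L i) V = 0) ∪
      A.filter fun m => Attached A L m V := by
    intro m hm
    simp only [Finset.mem_filter, Finset.mem_union] at hm ⊢
    have := hF2 m hm.1
    rw [hm.2] at this
    tauto
  have hatt : (A.filter fun m => Attached A L m V).card ≤ 9 := by
    have : (Finset.univ : Finset (SignType × SignType)).card = 9 := rfl
    rw [← this]
    refine Finset.card_le_card_of_injOn (fun m =>
      (SignType.sign (lineEval (L m) V * lineDet (L i) (L m)),
        SignType.sign (lineEval (L m) V * lineDet (L j) (L m)))) (fun _ _ => Finset.mem_univ _) ?_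
    intro m hm m' hm' heq
    simp only [Finset.coe_filter, Set.mem_ofPred_eq] at hm hm'
    simp only [Prod.mk.injEq] at heq
    exact eq_of_attached hL hss hi.1 hj.1 hij hm.1 hm'.1 hi.2 hj.2 hm.2 hm'.2 heq.1 heq.2
  have := (Finset.card_le_card hsub).trans (Finset.card_union_le _ _)
  omega

end Arrangement

section Space

open scoped RealInnerProductSpace

theorem coplanar_of_forall_inner_eq_zero {s : Set Pt3} {w p : Pt3} (hw : w ≠ 0)
    (h : ∀ x ∈ s, ⟪w, x - p⟫ = 0) : Coplanar ℝ s := by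
  have hle : vectorSpan ℝ s ≤ (ℝ ∙ w)ᗮ := by
    rw [vectorSpan_def, Submodule.span_le]
    rintro _ ⟨x, hx, y, hy, rfl⟩
    rw [SetLike.mem_coe, Submodule.mem_orthogonal_singleton_iff_inner_right]
    have := h x hx
    have h2 := h y hy
    simp only [vsub_eq_sub]
    rw [← sub_sub_sub_cancel_right x y p, inner_sub_right, this, h2, sub_zero]
  have : Fact (Module.finrank ℝ Pt3 = 2 + 1) := ⟨by simp⟩
  rw [coplanar_iff_finrank_le_two]
  exact (Submodule.finrank_mono hle).trans (Submodule.finrank_orthogonal_span_singleton hw).le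

theorem exists_orthogonal_frame {d : Pt3} (hd : d ≠ 0) : ∃ u v : Pt3, ⟪u, d⟫ = 0 ∧ ⟪v, d⟫ = 0 ∧
    (∀ x y : ℝ, x • u + y • v = 0 → x = 0 ∧ y = 0) ∧
    (∀ w : Pt3, ⟪w, d⟫ = 0 → ∃ x y : ℝ, w = x • u + y • v) ∧
    (∀ w : Pt3, ⟪u, w⟫ = 0 → ⟪v, w⟫ = 0 → ∃ c : ℝ, w = c • d) := by
  have : Fact (Module.finrank ℝ Pt3 = 2 + 1) := ⟨by simp⟩
  let b := OrthonormalBasis.fromOrthogonalSpanSingleton (𝕜 := ℝ) 2 hd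
  have hb : ∀ i, ⟪(b i : Pt3), d⟫ = 0 := fun i =>
    Submodule.mem_orthogonal_singleton_iff_inner_left.1 (b i).2
  have hspan : ∀ w : Pt3, ⟪w, d⟫ = 0 → ∃ x y : ℝ, w = x • (b 0 : Pt3) + y • (b 1 : Pt3) := by
    intro w hw
    have hw' : w ∈ (ℝ ∙ d)ᗮ := Submodule.mem_orthogonal_singleton_iff_inner_left.2 hw
    have := b.sum_repr ⟨w, hw'⟩
    rw [Fin.sum_univ_two] at this
    exact ⟨_, _, (congrArg Subtype.val this).symm⟩
  refine ⟨b 0, b 1, hb 0, hb 1, ?_, hspan, ?_⟩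
  · intro x y h
    have hli := b.toBasis.linearIndependent
    rw [Fintype.linearIndependent_iff] at hli
    have := hli ![x, y] (by
      rw [Fin.sum_univ_two]
      apply Subtype.ext
      simpa using h)
    exact ⟨this 0, this 1⟩
  · intro w h0 h1
    have hdd : ⟪d, d⟫ ≠ 0 := inner_self_ne_zero.2 hd
    refine ⟨⟪w, d⟫ / ⟪d, d⟫, ?_⟩
    set w' := w - (⟪w, d⟫ / ⟪d, d⟫) • d with hw'
    have e : ⟪w', d⟫ = 0 := by
      rw [hw', inner_sub_left, real_inner_smul_left]
      field_simp
      ring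
    obtain ⟨x, y, hxy⟩ := hspan w' e
    have e0 : ⟪(b 0 : Pt3), w'⟫ = 0 := by
      rw [hw', inner_sub_right, inner_smul_right, h0, hb]; simp
    have e1 : ⟪(b 1 : Pt3), w'⟫ = 0 := by
      rw [hw', inner_sub_right, inner_smul_right, h1, hb]; simp
    have : ⟪w', w'⟫ = 0 := by
      nth_rewrite 1 [hxy]
      rw [inner_add_left, real_inner_smul_left, real_inner_smul_left, e0, e1]; simp
    exact sub_eq_zero.1 (inner_self_eq_zero.1 this)

theorem dist_sq_sub_dist_sq (o p r : Pt3) :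
    dist o p ^ 2 - dist o r ^ 2 = 2 * ⟪o - p, r - p⟫ - ‖r - p‖ ^ 2 := by
  rw [dist_eq_norm, dist_eq_norm, ← sub_sub_sub_cancel_right o r p, norm_sub_sq_real (o - p)]
  ring

theorem card_le_spheres_through_pair {S : Set Pt3} (hS : S.Finite)
    (hsph : ¬ EuclideanGeometry.Cospherical S) (hpl : ¬ Coplanar ℝ S)
    (h4 : NoFourConcyclic S) (h3 : NoThreeCollinear S) {p q : Pt3} (hp : p ∈ S) (hq : q ∈ S)
    (hpq : p ≠ q) :
    {C : Set Pt3 | IsSphere C ∧ (S ∩ C).ncard = 4 ∧ p ∈ C ∧ q ∈ C}.Finite ∧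
    S.ncard ≤ 11 * {C : Set Pt3 | IsSphere C ∧ (S ∩ C).ncard = 4 ∧ p ∈ C ∧ q ∈ C}.ncard + 2 := by
  classical
  obtain ⟨u, v, hu, hv, hli, hspan, horth⟩ := exists_orthogonal_frame (sub_ne_zero.2 hpq.symm)
  set d := q - p with hd
  let o : ℝ × ℝ → Pt3 := fun V => p + (1 / 2 : ℝ) • d + V.1 • u + V.2 • v
  let L : Pt3 → ℝ × ℝ × ℝ := fun r =>
    (2 * ⟪u, r - p⟫, 2 * ⟪v, r - p⟫, ‖r - p‖ ^ 2 - ⟪d, r - p⟫)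
  have hoinj : ∀ P Q, o P = o Q → P = Q := by
    intro P Q h
    have h' : (P.1 - Q.1) • u + (P.2 - Q.2) • v = o P - o Q := by
      simp only [o]; module
    rw [h, sub_self] at h'
    obtain ⟨h1, h2⟩ := hli _ _ h'
    exact Prod.ext (sub_eq_zero.1 h1) (sub_eq_zero.1 h2)
  have hosub : ∀ V, o V - p = (1 / 2 : ℝ) • d + V.1 • u + V.2 • v := by
    intro V; simp only [o]; module
  have hoq : ∀ V, dist (o V) q = dist (o V) p := by
    intro V
    have := dist_sq_sub_dist_sq (o V) p q
    rw [hosub, ← hd, inner_add_left, inner_add_left, real_inner_smul_left, real_inner_smul_left,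
      real_inner_smul_left, hu, hv, real_inner_self_eq_norm_sq] at this
    have h2 : dist (o V) q ^ 2 = dist (o V) p ^ 2 := by linarith
    exact (pow_left_inj₀ dist_nonneg dist_nonneg two_ne_zero).1 h2
  have hcenter : ∀ c, dist c q = dist c p → ∃ V, o V = c := by
    intro c hc
    have := dist_sq_sub_dist_sq c p q
    rw [hc, ← hd] at this
    obtain ⟨x, y, hxy⟩ := hspan (c - p - (1 / 2 : ℝ) • d) (by
      rw [inner_sub_left, real_inner_smul_left, real_inner_self_eq_norm_sq]; linarith)
    refine ⟨(x, y), ?_⟩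
    simp only [o]
    rw [add_assoc, ← hxy]
    module
  have hline : ∀ r V, lineEval (L r) V = 0 ↔ dist (o V) r = dist (o V) p := by
    intro r V
    have h1 : lineEval (L r) V = dist (o V) p ^ 2 - dist (o V) r ^ 2 := by
      rw [dist_sq_sub_dist_sq, hosub, inner_add_left, inner_add_left, real_inner_smul_left,
        real_inner_smul_left, real_inner_smul_left]
      simp only [lineEval, L]
      ring
    rw [h1, sub_eq_zero, pow_left_inj₀ dist_nonneg dist_nonneg two_ne_zero, eq_comm]
  set A : Finset Pt3 := (hS.toFinset.erase p).erase q with hA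
  have hAmem : ∀ r, r ∈ A ↔ r ≠ q ∧ r ≠ p ∧ r ∈ S := by
    intro r; simp [hA]
  have hcard : A.card + 2 = S.ncard := by
    rw [Set.ncard_eq_toFinset_card _ hS]
    have h1 : q ∈ hS.toFinset.erase p := by simp [hq, hpq.symm]
    have h2 : p ∈ hS.toFinset := by simpa using hp
    rw [← Finset.card_erase_add_one h2, ← Finset.card_erase_add_one h1]
  have hL : ∀ r ∈ A, (L r).1 ≠ 0 ∨ (L r).2.1 ≠ 0 := by
    intro r hr
    obtain ⟨hrq, hrp, hrS⟩ := (hAmem r).1 hr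
    by_contra! h
    simp only [L, mul_eq_zero, OfNat.ofNat_ne_zero, false_or] at h
    obtain ⟨c, hc⟩ := horth _ h.1 h.2
    refine h3 {p, q, r} ?_ ?_ ?_
    · rintro x (rfl | rfl | rfl) <;> assumption
    · exact Set.ncard_eq_three.2 ⟨p, q, r, hpq, hrp.symm, hrq.symm, rfl⟩
    · rw [collinear_iff_of_mem (p₀ := p) (by simp)]
      refine ⟨d, ?_⟩
      rintro x (rfl | rfl | rfl)
      · exact ⟨0, by simp⟩
      · exact ⟨1, by simp [hd]⟩
      · exact ⟨c, by rw [← hc]; simp⟩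
  have hss : ∀ i ∈ A, ∀ j ∈ A, i ≠ j → ∀ P Q, lineEval (L i) P = 0 → lineEval (L j) P = 0 →
      lineEval (L i) Q = 0 → lineEval (L j) Q = 0 → P = Q := by
    intro i hi j hj hij P Q hiP hjP hiQ hjQ
    obtain ⟨hiq, hip, hiS⟩ := (hAmem i).1 hi
    obtain ⟨hjq, hjp, hjS⟩ := (hAmem j).1 hj
    by_contra hne
    rw [hline] at hiP hjP hiQ hjQ
    have key : ∀ x ∈ ({p, q, i, j} : Set Pt3), dist (o P) x = dist (o P) p ∧
        dist (o Q) x = dist (o Q) p := by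
      rintro x (rfl | rfl | rfl | rfl)
      · exact ⟨rfl, rfl⟩
      · exact ⟨hoq P, hoq Q⟩
      · exact ⟨hiP, hiQ⟩
      · exact ⟨hjP, hjQ⟩
    refine h4 {p, q, i, j} ?_ ?_ ⟨⟨o P, dist (o P) p, fun x hx => ?_⟩, ?_⟩
    · rintro x (rfl | rfl | rfl | rfl) <;> assumption
    · have h1 : i ∉ ({j} : Set Pt3) := by simpa using hij
      have h2 : q ∉ ({i, j} : Set Pt3) := by simp [hiq.symm, hjq.symm]
      have h3 : p ∉ ({q, i, j} : Set Pt3) := by simp [hip.symm, hjp.symm, hpq]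
      rw [Set.ncard_insert_of_notMem h3, Set.ncard_insert_of_notMem h2,
        Set.ncard_insert_of_notMem h1, Set.ncard_singleton]
    · rw [dist_comm]; exact (key x hx).1
    · refine coplanar_of_forall_inner_eq_zero (w := o P - o Q) (p := p)
        (sub_ne_zero.2 fun h => hne (hoinj P Q h)) fun x hx => ?_
      have e1 := dist_sq_sub_dist_sq (o P) p x
      have e2 := dist_sq_sub_dist_sq (o Q) p x
      rw [(key x hx).1] at e1
      rw [(key x hx).2] at e2
      rw [← sub_sub_sub_cancel_right (o P) (o Q) p, inner_sub_left]
      linarith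
  have hconc : ¬ ∃ P, ∀ i ∈ A, lineEval (L i) P = 0 := by
    rintro ⟨P, hP⟩
    refine hsph ⟨o P, dist (o P) p, fun x hx => ?_⟩
    rw [dist_comm]
    by_cases hxp : x = p
    · rw [hxp]
    by_cases hxq : x = q
    · rw [hxq, hoq]
    exact (hline x P).1 (hP x ((hAmem x).2 ⟨hxq, hxp, hx⟩))
  have hpar : ∃ i ∈ A, ∃ j ∈ A, lineDet (L i) (L j) ≠ 0 := by
    by_contra! h
    have hw : ∃ w : Pt3, w ≠ 0 ∧ ⟪w, d⟫ = 0 ∧ ∀ r ∈ A, ⟪w, r - p⟫ = 0 := by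
      rcases A.eq_empty_or_nonempty with hA0 | ⟨i, hi⟩
      · refine ⟨u, ?_, hu, by simp [hA0]⟩
        rintro rfl
        exact one_ne_zero (hli 1 0 (by simp)).1
      · refine ⟨(L i).2.1 • u + (-(L i).1) • v, fun h0 => ?_, ?_, fun r hr => ?_⟩
        · obtain ⟨h1, h2⟩ := hli _ _ h0
          rcases hL i hi with h5 | h5
          · exact h5 (neg_eq_zero.1 h2)
          · exact h5 h1
        · rw [inner_add_left, real_inner_smul_left, real_inner_smul_left, hu, hv]; ring
        · have := h i hi r hr
          rw [inner_add_left, real_inner_smul_left, real_inner_smul_left]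
          simp only [lineDet, L] at this ⊢
          linarith
    obtain ⟨w, hw0, hwd, hwr⟩ := hw
    refine hpl (coplanar_of_forall_inner_eq_zero (p := p) hw0 fun x hx => ?_)
    by_cases hxp : x = p
    · rw [hxp]; simp
    by_cases hxq : x = q
    · rw [hxq]; exact hwd
    exact hwr x ((hAmem x).2 ⟨hxq, hxp, hx⟩)
  set O := {V | (A.filter fun i => lineEval (L i) V = 0).card = 2} with hO
  let Φ : ℝ × ℝ → Set Pt3 := fun V => Metric.sphere (o V) (dist (o V) p)
  have hmemΦ : ∀ x V, x ∈ Φ V ↔ dist (o V) x = dist (o V) p := by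
    intro x V; simp only [Φ, Metric.mem_sphere, dist_comm x]
  have hncard : ∀ V, (S ∩ Φ V).ncard = (A.filter fun i => lineEval (L i) V = 0).card + 2 := by
    intro V
    have : S ∩ Φ V = ((insert p (insert q (A.filter fun i => lineEval (L i) V = 0)) :
        Finset Pt3) : Set Pt3) := by
      ext x
      simp only [Set.mem_inter_iff, hmemΦ, Finset.coe_insert, Set.mem_insert_iff, Finset.mem_coe,
        Finset.mem_filter, hAmem, hline]
      constructor
      · rintro ⟨h1, h2⟩
        tauto
      · rintro (rfl | rfl | h)
        · exact ⟨hp, rfl⟩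
        · exact ⟨hq, hoq V⟩
        · exact ⟨h.1.2.2, h.2⟩
    rw [this, Set.ncard_coe_finset, Finset.card_insert_of_notMem, Finset.card_insert_of_notMem]
    · simp [hAmem]
    · simp [hAmem, hpq]
  have himage : {C : Set Pt3 | IsSphere C ∧ (S ∩ C).ncard = 4 ∧ p ∈ C ∧ q ∈ C} = Φ '' O := by
    ext C
    constructor
    · rintro ⟨⟨c, ρ, hρ, rfl⟩, hC, hpC, hqC⟩
      rw [Metric.mem_sphere, dist_comm] at hpC hqC
      obtain ⟨V, rfl⟩ := hcenter c (hqC.trans hpC.symm)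
      have hΦ : Φ V = Metric.sphere (o V) ρ := by simp only [Φ, hpC]
      refine ⟨V, ?_, hΦ⟩
      rw [← hΦ, hncard] at hC
      exact Nat.add_right_cancel hC
    · rintro ⟨V, hV, rfl⟩
      refine ⟨⟨o V, dist (o V) p, ?_, rfl⟩, ?_, (hmemΦ p V).2 rfl, (hmemΦ q V).2 (hoq V)⟩
      · rw [dist_pos]
        intro h
        have := hoq V
        rw [h, dist_self, dist_eq_zero] at this
        exact hpq this
      · rw [hncard, show _ = 2 from hV]
  have hinj : Set.InjOn Φ O := by
    intro V hV V' _ h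
    obtain ⟨i, j, hij, hB⟩ := Finset.card_eq_two.1 hV
    have hi : i ∈ A.filter fun i => lineEval (L i) V = 0 := by rw [hB]; simp
    have hj : j ∈ A.filter fun i => lineEval (L i) V = 0 := by rw [hB]; simp
    simp only [Finset.mem_filter] at hi hj
    have htrans : ∀ r, lineEval (L r) V = 0 → lineEval (L r) V' = 0 := by
      intro r hr
      rw [hline, ← hmemΦ] at hr ⊢
      rwa [← h]
    exact hss i hi.1 j hj.1 hij V V' hi.2 hj.2 (htrans i hi.2) (htrans j hj.2)
  rw [himage]
  refine ⟨(finite_ordinary hss).image Φ, ?_⟩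
  rw [hinj.ncard_image, ← hcard]
  exact Nat.add_le_add_right (card_lines_le hL hss hconc hpar) 2

end Space

theorem stmt17 (S : Set Pt3) (hS : S.Finite) (n : ℕ) (hn : S.ncard = n)
    (hn5 : 5 ≤ n) (hsph : ¬ EuclideanGeometry.Cospherical S) (hpl : ¬ Coplanar ℝ S)
    (h4 : NoFourConcyclic S) (h3 : NoThreeCollinear S) :
    (sphereCount S 4 : ℝ) ≥ (9 / 208) * (n.choose 3 : ℝ) := by
  classical
  have hpair : ∀ p ∈ S, ∀ q ∈ S, p ≠ q → _ := fun p hp q hq hpq =>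
    card_le_spheres_through_pair hS hsph hpl h4 h3 hp hq hpq
  have hfin : {C : Set Pt3 | IsSphere C ∧ (S ∩ C).ncard = 4}.Finite := by
    refine Set.Finite.subset (s := ⋃ p ∈ S, ⋃ q ∈ S, {C : Set Pt3 | p ≠ q ∧
      (IsSphere C ∧ (S ∩ C).ncard = 4 ∧ p ∈ C ∧ q ∈ C)}) ?_ ?_
    · refine hS.biUnion fun p hp => hS.biUnion fun q hq => ?_
      by_cases hpq : p = q
      · simp [hpq]
      · exact (hpair p hp q hq hpq).1.subset fun C hC => hC.2
    · rintro C ⟨hC, hcard⟩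
      obtain ⟨p, hp, q, hq, hpq⟩ := (Set.one_lt_ncard (hS.inter_of_left C)).1 (by omega)
      simp only [Set.mem_iUnion]
      exact ⟨p, hp.1, q, hq.1, hpq, hC, hcard, hp.2, hq.2⟩
  have hcount := Finset.card_mul_le_card_mul (s := hS.toFinset.offDiag) (t := hfin.toFinset)
    (fun (x : Pt3 × Pt3) (C : Set Pt3) => x.1 ∈ C ∧ x.2 ∈ C) (m := (n - 2 + 10) / 11) (n := 12)
    (fun x hx => ?_) (fun C hC => ?_)
  · rw [Finset.offDiag_card, ← Set.ncard_eq_toFinset_card _ hS, ← Set.ncard_eq_toFinset_card _ hfin,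
      hn] at hcount
    have hle : n * (n - 1) * (n - 2) ≤ 132 * sphereCount S 4 := by
      have h1 : n - 2 ≤ 11 * ((n - 2 + 10) / 11) := by omega
      have h2 : n * (n - 1) = n * n - n := by rw [Nat.mul_sub, mul_one]
      calc n * (n - 1) * (n - 2) ≤ n * (n - 1) * (11 * ((n - 2 + 10) / 11)) :=
            Nat.mul_le_mul_left _ h1
        _ = 11 * ((n * n - n) * ((n - 2 + 10) / 11)) := by rw [h2]; ring
        _ ≤ 11 * (sphereCount S 4 * 12) := Nat.mul_le_mul_left _ hcount
        _ = 132 * sphereCount S 4 := by ring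
    have hchoose : 6 * n.choose 3 = n * (n - 1) * (n - 2) := by
      have := Nat.descFactorial_eq_factorial_mul_choose n 3
      simp only [Nat.descFactorial_succ, Nat.descFactorial_zero, Nat.factorial] at this
      simp only [tsub_zero, mul_one] at this
      linarith
    have hfinal : n.choose 3 ≤ 22 * sphereCount S 4 := by omega
    have : (n.choose 3 : ℝ) ≤ 22 * sphereCount S 4 := by exact_mod_cast hfinal
    have h0 : (0 : ℝ) ≤ n.choose 3 := Nat.cast_nonneg _
    linarith
  · simp only [Finset.mem_offDiag, Set.Finite.mem_toFinset] at hx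
    have := (hpair x.1 hx.1 x.2 hx.2.1 hx.2.2).2
    have heq : {C : Set Pt3 | IsSphere C ∧ (S ∩ C).ncard = 4 ∧ x.1 ∈ C ∧ x.2 ∈ C} =
        (Finset.bipartiteAbove (fun (x : Pt3 × Pt3) (C : Set Pt3) => x.1 ∈ C ∧ x.2 ∈ C)
          hfin.toFinset x : Set (Set Pt3)) := by
      ext C
      simp [Finset.bipartiteAbove, and_assoc]
    rw [heq, Set.ncard_coe_finset, hn] at this
    omega
  · simp only [Set.Finite.mem_toFinset, Set.mem_ofPred_eq] at hC
    have heq : Finset.bipartiteBelow (fun (x : Pt3 × Pt3) (C : Set Pt3) => x.1 ∈ C ∧ x.2 ∈ C)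
        hS.toFinset.offDiag C = (hS.toFinset.filter (· ∈ C)).offDiag := by
      ext x
      simp only [Finset.bipartiteBelow, Finset.mem_filter, Finset.mem_offDiag,
        Set.Finite.mem_toFinset]
      tauto
    have hc : (hS.toFinset.filter (· ∈ C)).card = 4 := by
      rw [← hC.2, ← Set.ncard_coe_finset]
      congr 1
      ext x
      simp
    rw [heq, Finset.offDiag_card, hc]
end
end

section
/- Let S be a configuration of n points lying on a plane π in ℝ³ with no four points of S collinear. Then there exist a point p ∉ π and a set S′ of n points, all lying on a sphere centered at p but with no four points of S′ cocircular, such that the central projection from p onto π maps S′ bijectively onto S (i.e., each point of S′ lies on the line through p and its image point of S). -/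
open Set

noncomputable section

/-- No four points of `S` are collinear. -/
def NoFourCollinear (S : Set Pt3) : Prop :=
  ∀ T ⊆ S, T.ncard = 4 → ¬ Collinear ℝ T

/-- A linear combination of distances to finitely many points, with some nonzero coefficient,
is nonzero on a dense set of points. -/
theorem dense_setOf_sum_mul_dist_ne_zero {E : Type*} [NormedAddCommGroup E]
    [InnerProductSpace ℝ E] (hE : 1 < Module.rank ℝ E) (T : Finset E) (w : E → ℝ)
    (hw : ∃ s ∈ T, w s ≠ 0) : Dense {p : E | ∑ s ∈ T, w s * ‖s - p‖ ≠ 0} := by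
  classical
  have : Nontrivial E := rank_pos_iff_nontrivial.mp (zero_lt_one.trans hE)
  obtain ⟨t, htT, ht⟩ := hw
  have hTd : Dense ((T : Set E)ᶜ) := T.countable_toSet.dense_compl ℝ
  have hconn : IsPreconnected ((T : Set E)ᶜ) :=
    (T.countable_toSet.isConnected_compl_of_one_lt_rank hE).isPreconnected
  have han : AnalyticOnNhd ℝ (fun p : E => ∑ s ∈ T, w s * ‖s - p‖) (T : Set E)ᶜ := by
    intro p hp
    refine ContDiffAt.analyticAt (ContDiffAt.sum fun s hs => contDiffAt_const.mul ?_)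
    refine (contDiffAt_const.sub contDiffAt_id).norm ℝ (sub_ne_zero.mpr ?_)
    rintro rfl
    exact hp hs
  have hcont : Continuous fun p : E => ∑ s ∈ T, w s * ‖s - p‖ := by fun_prop
  have hcompl : {p : E | ∑ s ∈ T, w s * ‖s - p‖ ≠ 0} = {p | ∑ s ∈ T, w s * ‖s - p‖ = 0}ᶜ := rfl
  rw [hcompl, ← interior_eq_empty_iff_dense_compl]
  by_contra hne
  obtain ⟨x, hx, hxT⟩ := hTd.inter_open_nonempty _ isOpen_interior
    (Set.nonempty_iff_ne_empty.mpr hne)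
  have hloc : (fun p : E => ∑ s ∈ T, w s * ‖s - p‖) =ᶠ[nhds x] 0 := by
    filter_upwards [mem_interior_iff_mem_nhds.mp hx] with y hy using hy
  have hzero : (fun p : E => ∑ s ∈ T, w s * ‖s - p‖) = fun _ => 0 :=
    hcont.ext_on hTd continuous_const
      (han.eqOn_zero_of_preconnected_of_eventuallyEq_zero hconn hxT hloc)
  have hnorm : (fun p : E => ‖t - p‖) =
      fun p => -(w t)⁻¹ * ∑ s ∈ T.erase t, w s * ‖s - p‖ := by
    funext p
    have h := congrFun hzero p
    simp only [← Finset.add_sum_erase T _ htT] at h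
    field_simp
    linarith
  have hdiff : DifferentiableAt ℝ (fun p : E => ‖t - p‖) t := by
    rw [hnorm]
    refine (DifferentiableAt.fun_sum fun s hs => ?_).const_mul _
    refine ((differentiableAt_const _).sub differentiableAt_id).norm ℝ ?_ |>.const_mul _
    exact sub_ne_zero.mpr (Finset.ne_of_mem_erase hs)
  refine not_differentiableAt_norm_zero E ?_
  have hcomp : DifferentiableAt ℝ ((fun p : E => ‖t - p‖) ∘ fun v => t - v) 0 :=
    DifferentiableAt.comp _ (by simpa using hdiff)
      ((differentiableAt_const _).sub differentiableAt_id)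
  simpa [Function.comp_def] using hcomp

section AffineRelations

variable {V : Type*} [AddCommGroup V] [Module ℝ V]

/-- Four distinct non-collinear points contain three affinely independent ones. -/
theorem exists_affineIndependent_triple {T : Finset V} (hT : T.card = 4)
    (hcol : ¬ Collinear ℝ (T : Set V)) :
    ∃ a b c d : V, a ≠ b ∧ a ≠ c ∧ a ≠ d ∧ b ≠ c ∧ b ≠ d ∧ c ≠ d ∧
      (T : Set V) = {a, b, c, d} ∧ AffineIndependent ℝ ![a, b, c] := by
  classical
  obtain ⟨a, b, c, d, hab, hac, had, hbc, hbd, hcd, rfl⟩ := Finset.card_eq_four.mp hT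
  by_cases h : Collinear ℝ ({a, b, c} : Set V)
  · refine ⟨a, b, d, c, hab, had, hac, hbd, hbc, hcd.symm, by ext; simp; tauto, ?_⟩
    rw [affineIndependent_iff_not_collinear_set]
    intro h'
    refine hcol ((collinear_insert_insert_of_mem_affineSpan_pair
      (h.mem_affineSpan_of_mem_of_ne (p₁ := a) (p₂ := b) (p₃ := c) ?_ ?_ ?_ hab)
      (h'.mem_affineSpan_of_mem_of_ne (p₁ := a) (p₂ := b) (p₃ := d) ?_ ?_ ?_ hab)).subset ?_)
    · simp
    · simp
    · simp
    · simp
    · simp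
    · simp
    · intro x
      simp
      tauto
  · exact ⟨a, b, c, d, hab, hac, had, hbc, hbd, hcd, by simp,
      affineIndependent_iff_not_collinear_set.mpr h⟩

/-- The affine relations between four distinct non-collinear points form a space of dimension
at most one. -/
theorem exists_eq_mul_of_affine_relations {T : Finset V} (hT : T.card = 4)
    (hcol : ¬ Collinear ℝ (T : Set V)) {v w : V → ℝ}
    (hv0 : ∑ s ∈ T, v s = 0) (hv : ∑ s ∈ T, v s • s = 0) (hvne : ∃ s ∈ T, v s ≠ 0)
    (hw0 : ∑ s ∈ T, w s = 0) (hw : ∑ s ∈ T, w s • s = 0) :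
    ∃ k : ℝ, ∀ s ∈ T, w s = k * v s := by
  classical
  obtain ⟨a, b, c, d, hab, hac, had, hbc, hbd, hcd, hTeq, hind⟩ :=
    exists_affineIndependent_triple hT hcol
  obtain rfl : T = {a, b, c, d} := by
    apply Finset.coe_injective
    simpa using hTeq
  have hzero : ∀ u : V → ℝ, u d = 0 → ∑ s ∈ ({a, b, c, d} : Finset V), u s = 0 →
      ∑ s ∈ ({a, b, c, d} : Finset V), u s • s = 0 → ∀ s ∈ ({a, b, c, d} : Finset V), u s = 0 := by
    intro u hud h0 h1
    have h := affineIndependent_iff.mp hind Finset.univ ![u a, u b, u c]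
    simp only [Fin.sum_univ_three, Matrix.cons_val] at h
    have h0' : u a + u b + u c = 0 := by
      simpa [Finset.sum_insert, hab, hac, had, hbc, hbd, hcd, hud, add_assoc] using h0
    have h1' : u a • a + u b • b + u c • c = 0 := by
      simpa [Finset.sum_insert, hab, hac, had, hbc, hbd, hcd, hud, add_assoc] using h1
    have h2 := h h0' h1'
    have ha := h2 0 (Finset.mem_univ _)
    have hb := h2 1 (Finset.mem_univ _)
    have hc := h2 2 (Finset.mem_univ _)
    simp only [Matrix.cons_val] at ha hb hc
    simp [ha, hb, hc, hud]
  have hvd : v d ≠ 0 := by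
    intro hvd
    obtain ⟨s, hs, hne⟩ := hvne
    exact hne (hzero v hvd hv0 hv s hs)
  refine ⟨w d / v d, fun s hs => ?_⟩
  have h := hzero (fun s => w s - w d / v d * v s) (by field_simp; ring)
    (by rw [Finset.sum_sub_distrib, ← Finset.mul_sum, hw0, hv0]; simp)
    (by simp_rw [sub_smul, mul_smul]
        rw [Finset.sum_sub_distrib, ← Finset.smul_sum, hw, hv]; simp) s hs
  linarith

/-- A linear relation between the vectors joining a point `p` to points of an affine subspace
not containing `p` has coefficient sum zero. -/
theorem sum_eq_zero_of_sum_smul_sub_eq_zero {P : AffineSubspace ℝ V} {p : V} (hp : p ∉ P)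
    {T : Finset V} (hT : ∀ s ∈ T, s ∈ P) {w : V → ℝ} (h : ∑ s ∈ T, w s • (s - p) = 0) :
    ∑ s ∈ T, w s = 0 := by
  by_contra hne
  obtain ⟨t, ht⟩ : T.Nonempty := Finset.nonempty_of_sum_ne_zero hne
  have hmem : ∑ s ∈ T, w s • (s - t) ∈ P.direction :=
    P.direction.sum_mem fun s hs =>
      P.direction.smul_mem _ (AffineSubspace.vsub_mem_direction (hT s hs) (hT t ht))
  have heq : ∑ s ∈ T, w s • (s - t) = (∑ s ∈ T, w s) • (p - t) := by
    have hsplit : ∀ s, w s • (s - t) = w s • (s - p) + w s • (p - t) := fun s => by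
      rw [← smul_add, sub_add_sub_cancel]
    simp_rw [hsplit]
    rw [Finset.sum_add_distrib, h, zero_add, Finset.sum_smul]
  rw [heq] at hmem
  have hdir : p - t ∈ P.direction := (P.direction.smul_mem_iff hne).mp hmem
  exact hp (by simpa using AffineSubspace.vadd_mem_of_mem_direction hdir (hT t ht))

/-- A coplanar set of four points satisfies a nontrivial affine relation. -/
theorem exists_affine_relation_of_coplanar {T : Finset V} (hT : T.card = 4)
    (h : Coplanar ℝ (T : Set V)) :
    ∃ w : V → ℝ, ∑ s ∈ T, w s • s = 0 ∧ ∑ s ∈ T, w s = 0 ∧ ∃ s ∈ T, w s ≠ 0 := by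
  apply exists_nontrivial_relation_sum_zero_of_not_affine_ind
  intro hind
  have hrank := hind.finrank_vectorSpan (n := 3) (by simpa using hT)
  have hfd := h.finiteDimensional_vectorSpan
  have hle := h.finrank_le_two
  have hrange : Set.range ((↑) : T → V) = T := Subtype.range_coe
  rw [hrange] at hrank
  omega

end AffineRelations

/-- The central projection of `s` from `p` to the unit sphere centered at `p`. -/
def toUnitSphere {E : Type*} [NormedAddCommGroup E] [NormedSpace ℝ E] (p s : E) : E :=
  p + ‖s - p‖⁻¹ • (s - p)

section UnitSphere

variable {E : Type*} [NormedAddCommGroup E] [NormedSpace ℝ E]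

theorem toUnitSphere_mem_sphere {p s : E} (h : s ≠ p) :
    toUnitSphere p s ∈ Metric.sphere p 1 := by
  have : ‖s - p‖ ≠ 0 := norm_ne_zero_iff.mpr (sub_ne_zero.mpr h)
  simp [toUnitSphere, norm_smul, this]

theorem collinear_toUnitSphere (p s : E) : Collinear ℝ {p, toUnitSphere p s, s} := by
  rw [collinear_iff_of_mem (p₀ := p) (by simp)]
  refine ⟨s - p, ?_⟩
  rintro x (rfl | rfl | rfl)
  · exact ⟨0, by simp⟩
  · exact ⟨‖s - p‖⁻¹, by simp [toUnitSphere, add_comm]⟩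
  · exact ⟨1, by simp⟩

theorem injOn_toUnitSphere {P : AffineSubspace ℝ E} {p : E} (hp : p ∉ P) :
    Set.InjOn (toUnitSphere p) (P : Set E) := by
  classical
  intro s hs t ht hst
  by_contra hne
  have hst' : ‖s - p‖⁻¹ • (s - p) = ‖t - p‖⁻¹ • (t - p) := add_left_cancel hst
  have hsum := sum_eq_zero_of_sum_smul_sub_eq_zero hp (T := {s, t})
    (w := fun x => if x = s then ‖s - p‖⁻¹ else -‖t - p‖⁻¹)
    (by rintro x hx; rcases Finset.mem_insert.mp hx with rfl | hx
        · exact hs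
        · rwa [Finset.mem_singleton.mp hx])
    (by rw [Finset.sum_pair hne]; simp [Ne.symm hne, hst'])
  rw [Finset.sum_pair hne] at hsum
  simp only [if_true, Ne.symm hne, if_false, ← sub_eq_add_neg, sub_eq_zero] at hsum
  rw [hsum] at hst'
  have htp : ‖t - p‖⁻¹ ≠ 0 :=
    inv_ne_zero (norm_ne_zero_iff.mpr (sub_ne_zero.mpr fun h => hp (h ▸ ht)))
  exact hne (sub_left_injective (smul_right_injective E htp hst'))

/-- If the images on the unit sphere of four points of an affine subspace are coplanar, then the
points satisfy a nontrivial affine relation annihilating their distances to the center. -/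
theorem exists_affine_relation_of_coplanar_image {P : AffineSubspace ℝ E} {p : E} (hp : p ∉ P)
    {T : Finset E} (hT : T.card = 4) (hTP : (T : Set E) ⊆ P)
    (h : Coplanar ℝ (toUnitSphere p '' T)) :
    ∃ w : E → ℝ, ∑ s ∈ T, w s = 0 ∧ ∑ s ∈ T, w s • s = 0 ∧ (∃ s ∈ T, w s ≠ 0) ∧
      ∑ s ∈ T, w s * ‖s - p‖ = 0 := by
  classical
  have hinj : Set.InjOn (toUnitSphere p) (T : Set E) := (injOn_toUnitSphere hp).mono hTP
  have hnorm : ∀ s ∈ T, ‖s - p‖ ≠ 0 := fun s hs =>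
    norm_ne_zero_iff.mpr (sub_ne_zero.mpr fun h => hp (h ▸ hTP hs))
  rw [← Finset.coe_image] at h
  obtain ⟨u, hu, hu0, x, hx, hux⟩ :=
    exists_affine_relation_of_coplanar (by rw [Finset.card_image_of_injOn hinj, hT]) h
  rw [Finset.sum_image hinj] at hu hu0
  obtain ⟨t, ht, rfl⟩ := Finset.mem_image.mp hx
  have hlin : ∑ s ∈ T, (u (toUnitSphere p s) * ‖s - p‖⁻¹) • (s - p) = 0 := by
    have hsplit : ∀ s, (u (toUnitSphere p s) * ‖s - p‖⁻¹) • (s - p) =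
        u (toUnitSphere p s) • toUnitSphere p s - u (toUnitSphere p s) • p := fun s => by
      rw [mul_smul, ← smul_sub]
      congr 1
      simp [toUnitSphere]
    simp_rw [hsplit]
    rw [Finset.sum_sub_distrib, hu, ← Finset.sum_smul, hu0]
    simp
  have hsum := sum_eq_zero_of_sum_smul_sub_eq_zero hp (fun s hs => hTP hs) hlin
  refine ⟨fun s => u (toUnitSphere p s) * ‖s - p‖⁻¹, hsum, ?_, ⟨t, ht, ?_⟩, ?_⟩
  · simp_rw [smul_sub] at hlin
    rwa [Finset.sum_sub_distrib, ← Finset.sum_smul, hsum, zero_smul, sub_zero] at hlin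
  · exact mul_ne_zero hux (inv_ne_zero (hnorm t ht))
  · rw [← hu0]
    exact Finset.sum_congr rfl fun s hs => by
      rw [mul_assoc, inv_mul_cancel₀ (hnorm s hs), mul_one]

end UnitSphere

/-- For a fixed non-collinear quadruple, generic points `p` admit no nontrivial affine relation
annihilating the distances to `p`. -/
theorem exists_isOpen_dense_forall_affine_relation {E : Type*} [NormedAddCommGroup E]
    [InnerProductSpace ℝ E] (hE : 1 < Module.rank ℝ E) {T : Finset E} (hT : T.card = 4)
    (hcol : ¬ Collinear ℝ (T : Set E)) :
    ∃ U : Set E, IsOpen U ∧ Dense U ∧ ∀ p ∈ U, ∀ w : E → ℝ, ∑ s ∈ T, w s = 0 →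
      ∑ s ∈ T, w s • s = 0 → (∃ s ∈ T, w s ≠ 0) → ∑ s ∈ T, w s * ‖s - p‖ ≠ 0 := by
  by_cases h : ∃ w : E → ℝ, ∑ s ∈ T, w s = 0 ∧ ∑ s ∈ T, w s • s = 0 ∧ ∃ s ∈ T, w s ≠ 0
  · obtain ⟨v, hv0, hv, hvne⟩ := h
    refine ⟨{p | ∑ s ∈ T, v s * ‖s - p‖ ≠ 0}, isOpen_ne_fun (by fun_prop) continuous_const,
      dense_setOf_sum_mul_dist_ne_zero hE T v hvne, fun p hp w hw0 hw hwne => ?_⟩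
    obtain ⟨k, hk⟩ := exists_eq_mul_of_affine_relations hT hcol hv0 hv hvne hw0 hw
    obtain ⟨t, ht, hwt⟩ := hwne
    have hk0 : k ≠ 0 := left_ne_zero_of_mul (hk t ht ▸ hwt)
    have hsum : ∑ s ∈ T, w s * ‖s - p‖ = k * ∑ s ∈ T, v s * ‖s - p‖ := by
      rw [Finset.mul_sum]
      exact Finset.sum_congr rfl fun s hs => by rw [hk s hs, mul_assoc]
    rw [hsum]
    exact mul_ne_zero hk0 hp
  · exact ⟨Set.univ, isOpen_univ, dense_univ, fun p _ w hw0 hw hwne => (h ⟨w, hw0, hw, hwne⟩).elim⟩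

/-- The complement of the affine span of three affinely independent points of space is open
and dense. -/
theorem isOpen_dense_compl_affineSpan_triple {a b c : Pt3} (h : AffineIndependent ℝ ![a, b, c]) :
    IsOpen ((affineSpan ℝ {a, b, c} : Set Pt3)ᶜ) ∧
      Dense ((affineSpan ℝ {a, b, c} : Set Pt3)ᶜ) := by
  refine ⟨(AffineSubspace.closed_of_finiteDimensional _).isOpen_compl, ?_⟩
  rw [← interior_eq_empty_iff_dense_compl]
  by_contra hne
  have htop := affineSpan_eq_top_of_nonempty_interior
    ((Set.nonempty_iff_ne_empty.mpr hne).mono (interior_mono (subset_convexHull ℝ _)))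
  rw [AffineSubspace.affineSpan_coe] at htop
  have hrange : Set.range ![a, b, c] = {a, b, c} := by
    ext x; simp; tauto
  rw [← hrange, h.affineSpan_eq_top_iff_card_eq_finrank_add_one] at htop
  simp at htop

theorem stmt18 (S : Set Pt3) (hS : S.Finite) (n : ℕ) (hn : S.ncard = n)
    (π : Set Pt3) (hπ : IsPlane π) (hSπ : S ⊆ π) (h4 : NoFourCollinear S) :
    ∃ (p : Pt3) (ρ : ℝ) (S' : Set Pt3) (f : Pt3 → Pt3),
      p ∉ π ∧ 0 < ρ ∧ S'.ncard = n ∧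
      S' ⊆ Metric.sphere p ρ ∧
      NoFourConcyclic S' ∧
      Set.BijOn f S' S ∧
      ∀ q ∈ S', Collinear ℝ {p, q, f q} := by
  classical
  obtain ⟨a, b, c, hind, rfl⟩ := hπ
  have hrank : 1 < Module.rank ℝ Pt3 := by
    rw [← Module.finrank_eq_rank]
    simp
  obtain ⟨hπo, hπd⟩ := isOpen_dense_compl_affineSpan_triple hind
  set Q : Finset (Finset Pt3) := hS.toFinset.powersetCard 4 with hQ
  have hQmem : ∀ T ∈ Q, (T : Set Pt3) ⊆ S ∧ T.card = 4 := fun T hT => by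
    simpa [hQ, Finset.mem_powersetCard, Set.Finite.subset_toFinset] using hT
  have hgen : ∀ T ∈ Q, ∃ U : Set Pt3, IsOpen U ∧ Dense U ∧ ∀ p ∈ U, ∀ w : Pt3 → ℝ,
      ∑ s ∈ T, w s = 0 → ∑ s ∈ T, w s • s = 0 → (∃ s ∈ T, w s ≠ 0) →
        ∑ s ∈ T, w s * ‖s - p‖ ≠ 0 := fun T hT =>
    exists_isOpen_dense_forall_affine_relation hrank (hQmem T hT).2
      (h4 T (hQmem T hT).1 (by rw [Set.ncard_coe_finset, (hQmem T hT).2]))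
  choose! U hUo hUd hU using hgen
  have hdense : Dense (⋂ T ∈ (Q : Set (Finset Pt3)), U T) :=
    dense_biInter_of_isOpen hUo Q.countable_toSet hUd
  obtain ⟨p, hpπ, hpU⟩ := (hπd.inter_of_isOpen_left hdense hπo).nonempty
  have hinj : Set.InjOn (toUnitSphere p) S := (injOn_toUnitSphere hpπ).mono hSπ
  have hinv : Set.LeftInvOn (Function.invFunOn (toUnitSphere p) S) (toUnitSphere p) S :=
    hinj.leftInvOn_invFunOn
  refine ⟨p, 1, toUnitSphere p '' S, Function.invFunOn (toUnitSphere p) S, hpπ, one_pos,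
    by rw [hinj.ncard_image, hn], ?_, ?_, ?_, ?_⟩
  · rintro _ ⟨s, hs, rfl⟩
    exact toUnitSphere_mem_sphere fun h => hpπ (h ▸ hSπ hs)
  · intro T' hT' hcard hconc
    obtain ⟨T, hTS, rfl⟩ := Set.subset_image_iff.mp hT'
    rw [(hinj.mono hTS).ncard_image] at hcard
    lift T to Finset Pt3 using hS.subset hTS
    rw [Set.ncard_coe_finset] at hcard
    obtain ⟨w, hw0, hw, hwne, hwd⟩ := exists_affine_relation_of_coplanar_image hpπ hcard
      (hTS.trans hSπ) hconc.Coplanar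
    have hTQ : T ∈ Q := by
      simpa [hQ, Finset.mem_powersetCard, Set.Finite.subset_toFinset] using ⟨hTS, hcard⟩
    exact hU T hTQ p (Set.mem_iInter₂.mp hpU T hTQ) w hw0 hw hwne hwd
  · exact ⟨by rintro _ ⟨s, hs, rfl⟩; rwa [hinv hs],
      by rintro _ ⟨s, hs, rfl⟩ _ ⟨t, ht, rfl⟩ h; rw [hinv hs, hinv ht] at h; rw [h],
      fun s hs => ⟨toUnitSphere p s, ⟨s, hs, rfl⟩, hinv hs⟩⟩
  · rintro _ ⟨s, hs, rfl⟩
    rw [hinv hs]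
    exact collinear_toUnitSphere p s
end
end
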